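/- Let n ≥ 2, let p be the greatest proper divisor of n, and let S be a semitransitive subsemigroup of the singular part I_n \ S_n of minimal cardinality, i.e., |S| = 2n − p + 1. Then the minimal cardinality of a transitivity block of S equals p, and the cardinality of every transitivity block of S is divisible by p. -/

import Mathlib

/-- `ISemi n` is the symmetric inverse semigroup `I_n`, realized as the set of all
partial injective maps (partial permutations) of the `n`-element set `Fin n`,
with composition given by `PEquiv.trans` (apply the left factor first, matching
the right-action convention `x φ`). -/
abbrev ISemi (n : ℕ) := PEquiv (Fin n) (Fin n)

/-- `S` is a subsemigroup of `I_n`: a subset closed under composition. -/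
def IsSubsemigroup {n : ℕ} (S : Set (ISemi n)) : Prop :=
  ∀ a ∈ S, ∀ b ∈ S, a.trans b ∈ S

/-- `φ` belongs to the singular part `I_n \ S_n`: its domain is a proper subset
of the underlying set, i.e. it is undefined somewhere. -/
def IsSingular {n : ℕ} (φ : ISemi n) : Prop :=
  ∃ x : Fin n, φ x = none

/-- `S` is semitransitive: for all `x, y` there is `φ ∈ S` with `φ x = y` or `φ y = x`. -/
def Semitransitive {n : ℕ} (S : Set (ISemi n)) : Prop :=
  ∀ x y : Fin n, ∃ φ ∈ S, φ x = some y ∨ φ y = some x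

/-- The semitransitivity preorder induced by `S`: `x ≥ y` iff some `φ ∈ S` maps `x` to `y`. -/
def STGe {n : ℕ} (S : Set (ISemi n)) (x y : Fin n) : Prop :=
  ∃ φ ∈ S, φ x = some y

/-- The transitivity block of `x`: the equivalence class of `x` under `x ≥ y ∧ y ≥ x`. -/
def STBlock {n : ℕ} (S : Set (ISemi n)) (x : Fin n) : Set (Fin n) :=
  {y | STGe S x y ∧ STGe S y x}

/-- `k`-th power of `φ` under composition (`pePow φ 0` is the identity). -/
def pePow {n : ℕ} (φ : ISemi n) : ℕ → ISemi n
  | 0 => PEquiv.refl (Fin n)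
  | k + 1 => (pePow φ k).trans φ


section Helpers

open scoped Classical

variable {n : ℕ} {S : Set (ISemi n)}

theorem trans_some {f g : ISemi n} {x y z : Fin n} (h : f x = some y) (h' : g y = some z) :
    (f.trans g) x = some z :=
  (PEquiv.trans_eq_some f g x z).2 ⟨y, h, h'⟩

theorem peInj {f : ISemi n} {x y z : Fin n} (h : f x = some z) (h' : f y = some z) : x = y :=
  PEquiv.inj f h h'

theorem pePow_add (f : ISemi n) (i j : ℕ) : pePow f (i + j) = (pePow f i).trans (pePow f j) := by
  induction j with
  | zero => simp [pePow]
  | succ k ih => rw [← add_assoc, pePow, ih, pePow, PEquiv.trans_assoc]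

theorem pePow_one (f : ISemi n) : pePow f 1 = f := by simp [pePow]

theorem pePow_mem (hS : IsSubsemigroup S) {f : ISemi n} (hf : f ∈ S) (k : ℕ) :
    pePow f (k + 1) ∈ S := by
  induction k with
  | zero => rwa [pePow_one]
  | succ k ih => exact hS _ ih _ hf

/-- A partial identity. -/
def Pid (e : ISemi n) : Prop := ∀ u v, e u = some v → u = v

instance : Finite (ISemi n) := Finite.of_injective (fun f : ISemi n => (f : Fin n → Option (Fin n)))
  DFunLike.coe_injective

theorem exists_pid_pow (f : ISemi n) : ∃ k, Pid (pePow f (k + 2)) := by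
  obtain ⟨i, j, hne, hij⟩ := Finite.exists_ne_map_eq_of_infinite (pePow f)
  wlog hlt : i < j generalizing i j
  · exact this j i hne.symm hij.symm (by omega)
  obtain ⟨d, rfl⟩ : ∃ d, j = i + d := ⟨j - i, by omega⟩
  have hd : 1 ≤ d := by omega
  have key : ∀ c m, pePow f (i + m + c * d) = pePow f (i + m) := by
    intro c
    induction c with
    | zero => simp
    | succ c ih =>
      intro m
      have : i + m + (c + 1) * d = (i + d) + (m + c * d) := by ring
      rw [this, pePow_add, ← hij, ← pePow_add, ← add_assoc, ih]
  set k := 2 * (i + 1) * d with hk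
  have hki : i + 2 ≤ k := by nlinarith
  refine ⟨k - 2, ?_⟩
  have hk2 : k - 2 + 2 = k := by omega
  rw [hk2]
  have hidem : (pePow f k).trans (pePow f k) = pePow f k := by
    rw [← pePow_add]
    have := key (2 * (i + 1)) (k - i)
    rwa [← hk, show i + (k - i) = k by omega] at this
  intro u v huv
  have h1 := huv
  rw [← hidem, PEquiv.trans_eq_some] at h1
  obtain ⟨w, hw, hwv⟩ := h1
  rw [huv] at hw
  cases hw
  exact peInj huv hwv

theorem STGe.trans (hS : IsSubsemigroup S) {x y z : Fin n} (h : STGe S x y) (h' : STGe S y z) :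
    STGe S x z := by
  obtain ⟨f, hf, hf'⟩ := h
  obtain ⟨g, hg, hg'⟩ := h'
  exact ⟨f.trans g, hS _ hf _ hg, trans_some hf' hg'⟩

theorem pePow_defined {f : ISemi n} {K : Set (Fin n)} (hK : ∀ u ∈ K, ∃ v ∈ K, f u = some v) (k : ℕ) :
    ∀ u ∈ K, ∃ v ∈ K, pePow f k u = some v := by
  induction k with
  | zero => intro u hu; exact ⟨u, hu, by simp [pePow]⟩
  | succ k ih =>
    intro u hu
    obtain ⟨v, hv, h⟩ := ih u hu
    obtain ⟨w, hw, h'⟩ := hK v hv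
    exact ⟨w, hw, trans_some h h'⟩

/-- A map stabilizing a set `K` permutes it, with cycles inside `S`. -/
theorem STGe.of_stable (hS : IsSubsemigroup S) {f : ISemi n} (hf : f ∈ S) {K : Set (Fin n)}
    (hK : ∀ u ∈ K, ∃ v ∈ K, f u = some v) {u v : Fin n} (hu : u ∈ K) (huv : f u = some v) :
    STGe S v u := by
  obtain ⟨k, hk⟩ := exists_pid_pow f
  obtain ⟨w, -, hw⟩ := pePow_defined hK (k + 2) u hu
  have := hk _ _ hw
  subst this
  rw [show k + 2 = 1 + (k + 1) by ring, pePow_add, pePow_one, PEquiv.trans_eq_some] at hw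
  obtain ⟨w, h1, h2⟩ := hw
  rw [huv] at h1
  cases h1
  exact ⟨_, pePow_mem hS hf k, h2⟩

theorem surj_of_stable {f : ISemi n} {K : Set (Fin n)} (hK : ∀ u ∈ K, ∃ v ∈ K, f u = some v)
    {v : Fin n} (hv : v ∈ K) : ∃ u ∈ K, f u = some v := by
  obtain ⟨k, hk⟩ := exists_pid_pow f
  obtain ⟨w, -, hw⟩ := pePow_defined hK (k + 2) v hv
  have := hk _ _ hw
  subst this
  obtain ⟨u, hu, hu'⟩ := pePow_defined hK (k + 1) v hv
  refine ⟨u, hu, ?_⟩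
  have h2 : pePow f (k + 2) v = f u := by
    change ((pePow f (k + 1)).trans f) v = _
    simp [PEquiv.trans, hu']
  rw [← h2, hw]

theorem symm_mem (hS : IsSubsemigroup S) {h : ISemi n} (hh : h ∈ S) {K : Set (Fin n)}
    (hd : ∀ u, (∃ v, h u = some v) ↔ u ∈ K) (hr : ∀ v, (∃ u, h u = some v) ↔ v ∈ K) :
    h.symm ∈ S := by
  obtain ⟨k, hk⟩ := exists_pid_pow h
  have hK : ∀ u ∈ K, ∃ v ∈ K, h u = some v := by
    intro u hu
    obtain ⟨v, hv⟩ := (hd u).2 hu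
    exact ⟨v, (hr v).1 ⟨u, hv⟩, hv⟩
  have heq : h.symm = pePow h (k + 1) := by
    have hiff : ∀ u v, h.symm v = some u ↔ pePow h (k + 1) v = some u := by
      intro u v
      rw [PEquiv.eq_some_iff]
      constructor
      · intro huv
        obtain ⟨w, -, hw⟩ := pePow_defined hK (k + 2) u ((hd u).1 ⟨v, huv⟩)
        have := hk _ _ hw
        subst this
        rw [show k + 2 = 1 + (k + 1) by ring, pePow_add, pePow_one, PEquiv.trans_eq_some] at hw
        obtain ⟨w, h1, h2⟩ := hw
        rw [huv] at h1
        cases h1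
        exact h2
      · intro hvu
        have hv : v ∈ K := by
          rw [show k + 1 = 1 + k by ring, pePow_add, pePow_one, PEquiv.trans_eq_some] at hvu
          obtain ⟨w, h1, -⟩ := hvu
          exact (hd v).1 ⟨w, h1⟩
        obtain ⟨w, -, hw⟩ := pePow_defined hK (k + 2) v hv
        have := hk _ _ hw
        subst this
        have h2 : pePow h (k + 2) v = h u := by
          change ((pePow h (k + 1)).trans h) v = _
          simp [PEquiv.trans, hvu]
        rw [← h2, hw]
    ext v u
    exact hiff u v
  rw [heq]
  exact pePow_mem hS hh k

/-- `y` lies in every partial identity of `S` containing `x`. -/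
def Anc (S : Set (ISemi n)) (x u : Fin n) : Prop :=
  ∀ e ∈ S, Pid e → e x = some x → e u = some u

theorem Anc.refl (x : Fin n) : Anc S x x := fun _ _ _ h => h

theorem Anc.trans {x y z : Fin n} (h : Anc S x y) (h' : Anc S y z) : Anc S x z :=
  fun e he hp hx => h' e he hp (h e he hp hx)

theorem Pid.trans_pid {e f : ISemi n} (he : Pid e) (hf : Pid f) : Pid (e.trans f) := by
  intro u v h
  obtain ⟨w, h1, h2⟩ := (PEquiv.trans_eq_some _ _ _ _).1 h
  rw [he _ _ h1, hf _ _ h2]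

theorem exists_least (hS : IsSubsemigroup S) {x : Fin n} (hx : STGe S x x) :
    ∃ e ∈ S, Pid e ∧ ∀ u, e u = some u ↔ Anc S x u := by
  have hne : ∃ e, e ∈ S ∧ Pid e ∧ e x = some x := by
    obtain ⟨f, hf, hfx⟩ := hx
    obtain ⟨k, hk⟩ := exists_pid_pow f
    refine ⟨_, pePow_mem hS hf (k + 1), hk, ?_⟩
    obtain ⟨v, hv, h⟩ := pePow_defined (K := {x}) (f := f) (by simpa using hfx) (k + 2) x rfl
    rw [h, hv]
  let c : ISemi n → ℕ := fun e => (Finset.univ.filter (fun u => e u = some u)).card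
  obtain ⟨e, ⟨he, hp, hex⟩, hmin⟩ :=
    Set.exists_min_image {e : ISemi n | e ∈ S ∧ Pid e ∧ e x = some x} c (Set.toFinite _) hne
  refine ⟨e, he, hp, fun u => ⟨fun hu f hf hfp hfx => ?_, fun h => h e he hp hex⟩⟩
  have hm := hmin (e.trans f) ⟨hS _ he _ hf, hp.trans_pid hfp, trans_some hex hfx⟩
  have hsub : Finset.univ.filter (fun u => (e.trans f) u = some u) ⊆
      Finset.univ.filter (fun u => e u = some u) := by
    intro v hv
    simp only [Finset.mem_filter, Finset.mem_univ, true_and] at hv ⊢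
    obtain ⟨w, h1, h2⟩ := (PEquiv.trans_eq_some _ _ _ _).1 hv
    rw [hfp _ _ h2] at h1
    exact h1
  have heq := Finset.eq_of_subset_of_card_le hsub hm
  have : u ∈ Finset.univ.filter (fun u => (e.trans f) u = some u) := by
    rw [heq]; simpa using hu
  simp only [Finset.mem_filter, Finset.mem_univ, true_and] at this
  obtain ⟨w, h1, h2⟩ := (PEquiv.trans_eq_some _ _ _ _).1 this
  rw [hu] at h1
  cases h1
  exact h2

/-- The units of the local monoid at the least partial identity containing `x`. -/
structure Un (S : Set (ISemi n)) (x : Fin n) (h : ISemi n) : Prop where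
  mem : h ∈ S
  symm_mem : h.symm ∈ S
  dom : ∀ u, (∃ v, h u = some v) ↔ Anc S x u
  ran : ∀ v, (∃ u, h u = some v) ↔ Anc S x v

theorem Un.symm {x : Fin n} {h : ISemi n} (hh : Un S x h) : Un S x h.symm where
  mem := hh.symm_mem
  symm_mem := by simpa using hh.mem
  dom := fun u => by simpa only [PEquiv.eq_some_iff] using hh.ran u
  ran := fun u => by simpa only [PEquiv.eq_some_iff] using hh.dom u

theorem Un.trans (hS : IsSubsemigroup S) {x : Fin n} {g h : ISemi n} (hg : Un S x g)
    (hh : Un S x h) : Un S x (g.trans h) where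
  mem := hS _ hg.mem _ hh.mem
  symm_mem := hS _ hh.symm_mem _ hg.symm_mem
  dom := fun u => by
    constructor
    · rintro ⟨v, hv⟩
      obtain ⟨w, h1, -⟩ := (PEquiv.trans_eq_some _ _ _ _).1 hv
      exact (hg.dom u).1 ⟨w, h1⟩
    · intro hu
      obtain ⟨v, hv⟩ := (hg.dom u).2 hu
      obtain ⟨w, hw⟩ := (hh.dom v).2 ((hg.ran v).1 ⟨u, hv⟩)
      exact ⟨w, trans_some hv hw⟩
  ran := fun u => by
    constructor
    · rintro ⟨v, hv⟩
      obtain ⟨w, -, h1⟩ := (PEquiv.trans_eq_some _ _ _ _).1 hv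
      exact (hh.ran u).1 ⟨w, h1⟩
    · intro hu
      obtain ⟨v, hv⟩ := (hh.ran u).2 hu
      obtain ⟨w, hw⟩ := (hg.ran v).2 ((hh.dom v).1 ⟨u, hv⟩)
      exact ⟨w, trans_some hw hv⟩

theorem exists_un_id (hS : IsSubsemigroup S) {x : Fin n} (hx : STGe S x x) :
    ∃ e, Un S x e ∧ Pid e ∧ ∀ u, e u = some u ↔ Anc S x u := by
  obtain ⟨e, he, hp, h⟩ := exists_least hS hx
  have hd : ∀ u, (∃ v, e u = some v) ↔ u ∈ {u | Anc S x u} := by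
    intro u
    refine ⟨fun ⟨v, hv⟩ => ?_, fun hu => ⟨u, (h u).2 hu⟩⟩
    have := hp _ _ hv
    subst this
    exact (h u).1 hv
  have hr : ∀ v, (∃ u, e u = some v) ↔ v ∈ {u | Anc S x u} := by
    intro v
    refine ⟨fun ⟨u, hv⟩ => ?_, fun hu => ⟨v, (h v).2 hu⟩⟩
    have := hp _ _ hv
    subst this
    exact (h u).1 hv
  exact ⟨e, ⟨he, _root_.symm_mem hS he hd hr, hd, hr⟩, hp, h⟩

theorem un_of_fix (hS : IsSubsemigroup S) {x : Fin n} {r s : ISemi n} (hr : r ∈ S) (hs : s ∈ S)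
    (hrd : ∀ u v, r u = some v → Anc S x u ∧ Anc S x v)
    (hsd : ∀ u v, s u = some v → Anc S x u ∧ Anc S x v)
    (hfix : (r.trans s) x = some x) : Un S x r ∧ Un S x s := by
  have hg := hS _ hr _ hs
  obtain ⟨k, hk⟩ := exists_pid_pow (r.trans s)
  have hx : pePow (r.trans s) (k + 2) x = some x := by
    obtain ⟨v, hv, h⟩ := pePow_defined (K := {x}) (f := r.trans s)
      (by intro u hu; rw [Set.mem_singleton_iff.1 hu]; exact ⟨x, rfl, hfix⟩) (k + 2) x rfl
    rw [h, hv]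
  have hall : ∀ u, Anc S x u → pePow (r.trans s) (k + 2) u = some u :=
    fun u hu => hu _ (pePow_mem hS hg (k + 1)) hk hx
  have hgd : ∀ u, Anc S x u → ∃ v, (r.trans s) u = some v := by
    intro u hu
    have := hall u hu
    rw [show k + 2 = 1 + (k + 1) by ring, pePow_add, pePow_one, PEquiv.trans_eq_some] at this
    exact ⟨_, this.choose_spec.1⟩
  have hrd' : ∀ u, Anc S x u → ∃ v, r u = some v := by
    intro u hu
    obtain ⟨v, hv⟩ := hgd u hu
    obtain ⟨w, h1, -⟩ := (PEquiv.trans_eq_some _ _ _ _).1 hv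
    exact ⟨w, h1⟩
  have hrK : ∀ u ∈ {u | Anc S x u}, ∃ v ∈ {u | Anc S x u}, r u = some v := by
    intro u hu
    obtain ⟨v, hv⟩ := hrd' u hu
    exact ⟨v, (hrd _ _ hv).2, hv⟩
  have hsd' : ∀ u, Anc S x u → ∃ v, s u = some v := by
    intro u hu
    obtain ⟨v, hvA, hv⟩ := surj_of_stable hrK (v := u) hu
    obtain ⟨w, hw⟩ := hgd v hvA
    obtain ⟨w', h1, h2⟩ := (PEquiv.trans_eq_some _ _ _ _).1 hw
    rw [hv] at h1
    cases h1
    exact ⟨w, h2⟩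
  have hsK : ∀ u ∈ {u | Anc S x u}, ∃ v ∈ {u | Anc S x u}, s u = some v := by
    intro u hu
    obtain ⟨v, hv⟩ := hsd' u hu
    exact ⟨v, (hsd _ _ hv).2, hv⟩
  have mk : ∀ t ∈ S, (∀ u v, t u = some v → Anc S x u ∧ Anc S x v) →
      (∀ u ∈ {u | Anc S x u}, ∃ v ∈ {u | Anc S x u}, t u = some v) → Un S x t := by
    intro t ht h1 h2
    have hd : ∀ u, (∃ v, t u = some v) ↔ u ∈ {u | Anc S x u} := fun u =>
      ⟨fun ⟨v, hv⟩ => (h1 _ _ hv).1, fun hu => let ⟨v, _, hv⟩ := h2 u hu; ⟨v, hv⟩⟩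
    have hr : ∀ v, (∃ u, t u = some v) ↔ v ∈ {u | Anc S x u} := fun v =>
      ⟨fun ⟨u, hv⟩ => (h1 _ _ hv).2, fun hu => let ⟨u, _, hv⟩ := surj_of_stable h2 hu; ⟨u, hv⟩⟩
    exact ⟨ht, _root_.symm_mem hS ht hd hr, hd, hr⟩
  exact ⟨mk r hr hrd hrK, mk s hs hsd hsK⟩

/-- Mutual reachability. -/
def Eqv (S : Set (ISemi n)) (x y : Fin n) : Prop := STGe S x y ∧ STGe S y x

theorem Eqv.symm {x y : Fin n} (h : Eqv S x y) : Eqv S y x := ⟨h.2, h.1⟩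

theorem Eqv.trans (hS : IsSubsemigroup S) {x y z : Fin n} (h : Eqv S x y) (h' : Eqv S y z) :
    Eqv S x z := ⟨h.1.trans hS h'.1, h'.2.trans hS h.2⟩

/-- Equivalent points lying in the same least partial identity. -/
structure Cell (S : Set (ISemi n)) (b y : Fin n) : Prop where
  eqv : Eqv S b y
  anc : Anc S b y
  anc' : Anc S y b

theorem Cell.symm {b y : Fin n} (h : Cell S b y) : Cell S y b := ⟨h.eqv.symm, h.anc', h.anc⟩

theorem Cell.trans (hS : IsSubsemigroup S) {x y z : Fin n} (h : Cell S x y) (h' : Cell S y z) :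
    Cell S x z := ⟨h.eqv.trans hS h'.eqv, h.anc.trans h'.anc, h'.anc'.trans h.anc'⟩

theorem Cell.anc_iff {b y : Fin n} (h : Cell S b y) (u : Fin n) : Anc S b u ↔ Anc S y u :=
  ⟨fun hu => h.anc'.trans hu, fun hu => h.anc.trans hu⟩

theorem Un.congr {b y : Fin n} {h : ISemi n} (hc : Cell S b y) (hh : Un S y h) : Un S b h :=
  ⟨hh.mem, hh.symm_mem, fun u => by rw [hc.anc_iff]; exact hh.dom u,
    fun u => by rw [hc.anc_iff]; exact hh.ran u⟩

/-- The restriction of a map to the least partial identity containing `x`. -/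
theorem exists_corner (hS : IsSubsemigroup S) {x : Fin n} (hx : STGe S x x) {s : ISemi n}
    (hs : s ∈ S) : ∃ t ∈ S, (∀ u v, t u = some v ↔ s u = some v ∧ Anc S x u ∧ Anc S x v) := by
  obtain ⟨e, he, hp, h⟩ := exists_least hS hx
  refine ⟨(e.trans s).trans e, hS _ (hS _ he _ hs) _ he, fun u v => ?_⟩
  constructor
  · intro huv
    obtain ⟨w, h1, h2⟩ := (PEquiv.trans_eq_some _ _ _ _).1 huv
    obtain ⟨w', h3, h4⟩ := (PEquiv.trans_eq_some _ _ _ _).1 h1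
    have := hp _ _ h2
    subst this
    have := hp _ _ h3
    subst this
    exact ⟨h4, (h _).1 h3, (h _).1 h2⟩
  · rintro ⟨h1, h2, h3⟩
    exact trans_some (trans_some ((h _).2 h2) h1) ((h _).2 h3)

theorem exists_left (hS : IsSubsemigroup S) {x : Fin n} (hx : STGe S x x) {s : ISemi n}
    (hs : s ∈ S) : ∃ t ∈ S, (∀ u v, t u = some v ↔ s u = some v ∧ Anc S x u) := by
  obtain ⟨e, he, hp, h⟩ := exists_least hS hx
  refine ⟨e.trans s, hS _ he _ hs, fun u v => ?_⟩
  constructor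
  · intro huv
    obtain ⟨w', h3, h4⟩ := (PEquiv.trans_eq_some _ _ _ _).1 huv
    have := hp _ _ h3
    subst this
    exact ⟨h4, (h _).1 h3⟩
  · rintro ⟨h1, h2⟩
    exact trans_some ((h _).2 h2) h1

theorem exists_right (hS : IsSubsemigroup S) {x : Fin n} (hx : STGe S x x) {s : ISemi n}
    (hs : s ∈ S) : ∃ t ∈ S, (∀ u v, t u = some v ↔ s u = some v ∧ Anc S x v) := by
  obtain ⟨e, he, hp, h⟩ := exists_least hS hx
  refine ⟨s.trans e, hS _ hs _ he, fun u v => ?_⟩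
  constructor
  · intro huv
    obtain ⟨w', h3, h4⟩ := (PEquiv.trans_eq_some _ _ _ _).1 huv
    have := hp _ _ h4
    subst this
    exact ⟨h3, (h _).1 h4⟩
  · rintro ⟨h1, h2⟩
    exact trans_some h1 ((h _).2 h2)

theorem Cell.exists_un (hS : IsSubsemigroup S) {b y z : Fin n} (hy : Cell S b y)
    (hz : Cell S b z) : ∃ h, Un S b h ∧ h y = some z := by
  have hyz : Cell S y z := hy.symm.trans hS hz
  have hyy : STGe S y y := hyz.eqv.1.trans hS hyz.eqv.2
  obtain ⟨s, hs, hs'⟩ := hyz.eqv.1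
  obtain ⟨t, ht, ht'⟩ := hyz.eqv.2
  obtain ⟨s1, hs1, hs1'⟩ := exists_corner hS hyy hs
  obtain ⟨t1, ht1, ht1'⟩ := exists_corner hS hyy ht
  have h1 : s1 y = some z := (hs1' _ _).2 ⟨hs', Anc.refl _, hyz.anc⟩
  have h2 : t1 z = some y := (ht1' _ _).2 ⟨ht', hyz.anc, Anc.refl _⟩
  have := un_of_fix hS hs1 ht1 (fun u v h => ((hs1' u v).1 h).2) (fun u v h => ((ht1' u v).1 h).2)
    (trans_some h1 h2)
  exact ⟨s1, this.1.congr hy, h1⟩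

theorem Un.cell {b y z : Fin n} (hS : IsSubsemigroup S) {h : ISemi n} (hh : Un S b h)
    (hy : Cell S b y) (hyz : h y = some z) : Cell S b z := by
  have hbz := (hh.ran z).1 ⟨y, hyz⟩
  refine ⟨hy.eqv.trans hS ⟨⟨h, hh.mem, hyz⟩, ⟨h.symm, hh.symm_mem, (PEquiv.eq_some_iff _).2 hyz⟩⟩,
    hbz, ?_⟩
  intro e he hp hez
  have hf : Pid ((h.trans e).trans h.symm) := by
    intro u v huv
    obtain ⟨w, h1, h2⟩ := (PEquiv.trans_eq_some _ _ _ _).1 huv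
    obtain ⟨w', h3, h4⟩ := (PEquiv.trans_eq_some _ _ _ _).1 h1
    have := hp _ _ h4
    subst this
    exact peInj h3 ((PEquiv.eq_some_iff _).1 h2)
  have hfS := hS _ (hS _ hh.mem _ he) _ hh.symm_mem
  have hfy : ((h.trans e).trans h.symm) y = some y :=
    trans_some (trans_some hyz hez) ((PEquiv.eq_some_iff _).2 hyz)
  have hK : ∀ u ∈ {u | Anc S b u}, ∃ v ∈ {u | Anc S b u}, h u = some v := by
    intro u hu
    obtain ⟨v, hv⟩ := (hh.dom u).2 hu
    exact ⟨v, (hh.ran v).1 ⟨u, hv⟩, hv⟩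
  have hL : ∀ u ∈ {u | Anc S b u}, ∃ v, h u = some v ∧ e v = some v := by
    intro u hu
    have := (hy.anc'.trans hu) _ hfS hf hfy
    obtain ⟨w, h1, h2⟩ := (PEquiv.trans_eq_some _ _ _ _).1 this
    obtain ⟨w', h3, h4⟩ := (PEquiv.trans_eq_some _ _ _ _).1 h1
    have := hp _ _ h4
    subst this
    exact ⟨_, h3, h4⟩
  obtain ⟨u, hu, hub⟩ := surj_of_stable hK (v := b) (Anc.refl _)
  obtain ⟨v, hv, hev⟩ := hL u hu
  rw [hub] at hv
  cases hv
  exact hev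

theorem card_le_of_map {h : ISemi n} {A B : Finset (Fin n)} (H : ∀ a ∈ A, ∃ b ∈ B, h a = some b) :
    A.card ≤ B.card := by
  choose! φ hφ hφ' using H
  refine Finset.card_le_card_of_injOn φ hφ ?_
  intro a ha a' ha' haa
  have h1 := hφ' a ha
  have h2 := hφ' a' ha'
  rw [← haa] at h2
  exact peInj h1 h2

theorem card_le_of_map_symm {h : ISemi n} {A B : Finset (Fin n)}
    (H : ∀ b ∈ B, ∃ a ∈ A, h a = some b) : B.card ≤ A.card := by
  refine card_le_of_map (h := h.symm) fun b hb => ?_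
  obtain ⟨a, ha, hab⟩ := H b hb
  exact ⟨a, ha, (PEquiv.eq_some_iff _).2 hab⟩

theorem surj_of_map {h : ISemi n} {A B : Finset (Fin n)} (H : ∀ a ∈ A, ∃ b ∈ B, h a = some b)
    (hc : B.card ≤ A.card) : ∀ b ∈ B, ∃ a ∈ A, h a = some b := by
  choose! φ hφ hφ' using H
  have hinj : Set.InjOn φ A := by
    intro a ha a' ha' haa
    have h1 := hφ' a ha
    have h2 := hφ' a' ha'
    rw [← haa] at h2
    exact peInj h1 h2
  intro b hb
  obtain ⟨a, ha, hab⟩ := Finset.surjOn_of_injOn_of_card_le φ hφ hinj hc hb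
  exact ⟨a, ha, hab ▸ hφ' a ha⟩

theorem map_of_surj {h : ISemi n} {A B : Finset (Fin n)} (H : ∀ b ∈ B, ∃ a ∈ A, h a = some b)
    (hc : A.card ≤ B.card) : ∀ a ∈ A, ∃ b ∈ B, h a = some b := by
  have := surj_of_map (h := h.symm) (A := B) (B := A)
    (fun b hb => let ⟨a, ha, hab⟩ := H b hb; ⟨a, ha, (PEquiv.eq_some_iff _).2 hab⟩) hc
  intro a ha
  obtain ⟨b, hb, hab⟩ := this a ha
  exact ⟨b, hb, (PEquiv.eq_some_iff _).1 hab⟩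

/-- If every pair in `P × Q` is joined by exactly one map of a small family `M`, then `P` or `Q`
is small. -/
theorem card_le_of_unique_joins {M : Finset (ISemi n)} {P Q : Finset (Fin n)} {c : ℕ}
    (hP : P.Nonempty) (hQ : Q.Nonempty)
    (hu : ∀ a ∈ P, ∀ b ∈ Q, ∀ θ ∈ M, ∀ θ' ∈ M, θ a = some b → θ' a = some b → θ = θ')
    (hM : ∀ θ ∈ M, (∀ a ∈ P, ∃ b ∈ Q, θ a = some b) ∨ (∀ b ∈ Q, ∃ a ∈ P, θ a = some b))
    (hc : P.card + Q.card ≤ M.card + c) : P.card ≤ c ∨ Q.card ≤ c := by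
  rcases le_total P.card Q.card with h | h
  · left
    have H : ∀ θ ∈ M, ∀ a ∈ P, ∃ b ∈ Q, θ a = some b := by
      intro θ hθ
      rcases hM θ hθ with h1 | h1
      · exact h1
      · exact map_of_surj h1 h
    obtain ⟨a, ha⟩ := hP
    have : Nonempty (Fin n) := ⟨a⟩
    have : M.card ≤ Q.card := by
      choose! φ hφ using fun θ hθ => H θ hθ a ha
      refine Finset.card_le_card_of_injOn φ (fun θ hθ => (hφ θ hθ).1) ?_
      intro θ hθ θ' hθ' he
      exact hu a ha _ (hφ θ hθ).1 θ hθ θ' hθ' (hφ θ hθ).2 (he ▸ (hφ θ' hθ').2)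
    omega
  · right
    have H : ∀ θ ∈ M, ∀ b ∈ Q, ∃ a ∈ P, θ a = some b := by
      intro θ hθ
      rcases hM θ hθ with h1 | h1
      · exact surj_of_map h1 h
      · exact h1
    obtain ⟨b, hb⟩ := hQ
    have : Nonempty (Fin n) := ⟨b⟩
    have : M.card ≤ P.card := by
      choose! φ hφ using fun θ hθ => H θ hθ b hb
      refine Finset.card_le_card_of_injOn φ (fun θ hθ => (hφ θ hθ).1) ?_
      intro θ hθ θ' hθ' he
      exact hu _ (hφ θ hθ).1 b hb θ hθ θ' hθ' (hφ θ hθ).2 (he ▸ (hφ θ' hθ').2)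
    omega

section Graph

variable {ε α β : Type*} {E : Finset ε} {V₁ : Finset α} {V₂ : Finset β} {f : ε → α → Prop}
  {g : ε → β → Prop}

theorem exists_closed_pair :
    ∃ F ⊆ V₁, ∃ F' ⊆ V₂, (∀ e ∈ E, (∀ a, f e a → a ∈ V₁) → (∀ b, g e b → b ∈ V₂) →
      (∀ a a', f e a → f e a' → a = a') → (∀ b b', g e b → g e b' → b = b') →
      ((∃ a ∈ F, f e a) ↔ ∃ b ∈ F', g e b)) ∧
      V₁.card + V₂.card + (E.filter fun e => (∃ a ∈ F, f e a) ∨ ∃ b ∈ F', g e b).card ≤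
        (E.filter fun e => (∃ a, f e a) ∨ ∃ b, g e b).card + F.card + F'.card := by
  let N : Finset α × Finset β → Finset ε := fun Z => E.filter fun e =>
    ((∃ a, f e a) ∨ ∃ b, g e b) ∧ (∀ a, f e a → a ∈ Z.1) ∧ (∀ b, g e b → b ∈ Z.2)
  obtain ⟨⟨Z₁, Z₂⟩, hZ, hmax⟩ := Finset.exists_max_image
    ((V₁.powerset ×ˢ V₂.powerset).filter fun Z => Z.1.card + Z.2.card ≤ (N Z).card)
    (fun Z => Z.1.card + Z.2.card) ⟨(∅, ∅), by simp⟩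
  simp only [Finset.mem_filter, Finset.mem_product, Finset.mem_powerset] at hZ hmax
  obtain ⟨⟨hZ1, hZ2⟩, hZN⟩ := hZ
  refine ⟨V₁ \ Z₁, Finset.sdiff_subset, V₂ \ Z₂, Finset.sdiff_subset, ?_, ?_⟩
  · intro e he hV1 hV2 hf hg
    constructor
    · rintro ⟨a, ha, hea⟩
      rw [Finset.mem_sdiff] at ha
      by_contra hcon
      push Not at hcon
      have hins : (insert a Z₁).card = Z₁.card + 1 := Finset.card_insert_of_notMem ha.2
      have hlt : (N (Z₁, Z₂)).card < (N (insert a Z₁, Z₂)).card := by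
        apply Finset.card_lt_card
        rw [Finset.ssubset_iff]
        refine ⟨e, ?_, ?_⟩
        · simp only [N, Finset.mem_filter, not_and]
          intro _ _ h
          exact absurd (h a hea) ha.2
        · intro e' he'
          rw [Finset.mem_insert] at he'
          rcases he' with rfl | he'
          · simp only [N, Finset.mem_filter]
            refine ⟨he, .inl ⟨a, hea⟩, fun a' ha' => ?_, fun b hb => ?_⟩
            · rw [hf _ _ ha' hea]; exact Finset.mem_insert_self _ _
            · by_contra hb'
              exact hcon b (Finset.mem_sdiff.2 ⟨hV2 _ hb, hb'⟩) hb
          · simp only [N, Finset.mem_filter] at he' ⊢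
            exact ⟨he'.1, he'.2.1, fun a' h' => Finset.mem_insert_of_mem (he'.2.2.1 a' h'),
              he'.2.2.2⟩
      have := hmax (insert a Z₁, Z₂) ⟨⟨Finset.insert_subset ha.1 hZ1, hZ2⟩, by
        change (insert a Z₁).card + Z₂.card ≤ _
        omega⟩
      change (insert a Z₁).card + Z₂.card ≤ _ at this
      change _ ≤ Z₁.card + Z₂.card at this
      omega
    · rintro ⟨a, ha, hea⟩
      rw [Finset.mem_sdiff] at ha
      by_contra hcon
      push Not at hcon
      have hins : (insert a Z₂).card = Z₂.card + 1 := Finset.card_insert_of_notMem ha.2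
      have hlt : (N (Z₁, Z₂)).card < (N (Z₁, insert a Z₂)).card := by
        apply Finset.card_lt_card
        rw [Finset.ssubset_iff]
        refine ⟨e, ?_, ?_⟩
        · simp only [N, Finset.mem_filter, not_and]
          intro _ _ _ h
          exact absurd (h a hea) ha.2
        · intro e' he'
          rw [Finset.mem_insert] at he'
          rcases he' with rfl | he'
          · simp only [N, Finset.mem_filter]
            refine ⟨he, .inr ⟨a, hea⟩, fun b hb => ?_, fun a' ha' => ?_⟩
            · by_contra hb'
              exact hcon b (Finset.mem_sdiff.2 ⟨hV1 _ hb, hb'⟩) hb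
            · rw [hg _ _ ha' hea]; exact Finset.mem_insert_self _ _
          · simp only [N, Finset.mem_filter] at he' ⊢
            exact ⟨he'.1, he'.2.1, he'.2.2.1,
              fun a' h' => Finset.mem_insert_of_mem (he'.2.2.2 a' h')⟩
      have := hmax (Z₁, insert a Z₂) ⟨⟨hZ1, Finset.insert_subset ha.1 hZ2⟩, by
        change Z₁.card + (insert a Z₂).card ≤ _
        omega⟩
      change Z₁.card + (insert a Z₂).card ≤ _ at this
      change _ ≤ Z₁.card + Z₂.card at this
      omega
  · have h1 := Finset.card_sdiff_add_card_eq_card hZ1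
    have h2 := Finset.card_sdiff_add_card_eq_card hZ2
    have h3 : (N (Z₁, Z₂)).card +
        (E.filter fun e => (∃ a ∈ V₁ \ Z₁, f e a) ∨ ∃ b ∈ V₂ \ Z₂, g e b).card ≤
        (E.filter fun e => (∃ a, f e a) ∨ ∃ b, g e b).card := by
      rw [← Finset.card_union_of_disjoint]
      · apply Finset.card_le_card
        intro e he
        simp only [N, Finset.mem_union, Finset.mem_filter] at he ⊢
        rcases he with he | ⟨he, ⟨a, -, h⟩ | ⟨b, -, h⟩⟩
        · exact ⟨he.1, he.2.1⟩
        · exact ⟨he, .inl ⟨a, h⟩⟩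
        · exact ⟨he, .inr ⟨b, h⟩⟩
      · rw [Finset.disjoint_left]
        intro e he he'
        simp only [N, Finset.mem_filter, Finset.mem_sdiff] at he he'
        rcases he'.2 with ⟨a, h, h'⟩ | ⟨b, h, h'⟩
        · exact h.2 (he.2.2.1 a h')
        · exact h.2 (he.2.2.2 b h')
    omega

theorem card_le_of_hit {F : Finset α} (hf : ∀ e ∈ E, ∀ a a', f e a → f e a' → a = a')
    (hit : ∀ a ∈ F, ∃ e ∈ E, f e a) : F.card ≤ (E.filter fun e => ∃ a ∈ F, f e a).card := by
  obtain rfl | ⟨a₁, ha₁⟩ := F.eq_empty_or_nonempty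
  · simp
  have : Nonempty ε := ⟨(hit a₁ ha₁).choose⟩
  choose! φ hφ hφ' using hit
  refine Finset.card_le_card_of_injOn φ (fun a ha => ?_) ?_
  · exact Finset.mem_filter.2 ⟨hφ a ha, a, ha, hφ' a ha⟩
  · intro a ha a' ha' h
    exact hf _ (hφ a ha) _ _ (hφ' a ha) (h ▸ hφ' a' ha')

/-- Counting edges of a bipartite graph (with half-edges) in which unbalanced closed pairs are
small, and the equality case. -/
theorem graph_tight {t : ℕ} {a₀ : α} {b₀ : β}
    (hf : ∀ e ∈ E, ∀ a a', f e a → f e a' → a = a')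
    (hg : ∀ e ∈ E, ∀ b b', g e b → g e b' → b = b')
    (hfV : ∀ e ∈ E, ∀ a, f e a → a ∈ V₁) (hgV : ∀ e ∈ E, ∀ b, g e b → b ∈ V₂)
    (hit₂ : ∀ b ∈ V₂, ∃ e ∈ E, g e b)
    (ha₀ : a₀ ∈ V₁) (hb₀ : b₀ ∈ V₂) (hbase : ∀ e ∈ E, f e a₀ ↔ g e b₀)
    (bound : ∀ F ⊆ V₁, ∀ F' ⊆ V₂, (∀ e ∈ E, (∃ a ∈ F, f e a) ↔ ∃ b ∈ F', g e b) → F.card ≤ t) :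
    V₁.card + V₂.card ≤ E.card + t ∧ (E.card + t ≤ V₁.card + V₂.card →
      (∀ e ∈ E, (∃ a, f e a) ∨ ∃ b, g e b) ∧
      ∀ e ∈ E, ∀ e' ∈ E, f e a₀ → f e' a₀ → e = e') := by
  obtain ⟨F, hF, F', hF', hcl, hcard⟩ := exists_closed_pair (E := E) (V₁ := V₁) (V₂ := V₂)
    (f := f) (g := g)
  replace hcl : ∀ e ∈ E, (∃ a ∈ F, f e a) ↔ ∃ b ∈ F', g e b :=
    fun e he => hcl e he (hfV e he) (hgV e he) (hf e he) (hg e he)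
  have hFt := bound F hF F' hF' hcl
  have heq : (E.filter fun e => (∃ a ∈ F, f e a) ∨ ∃ b ∈ F', g e b) =
      E.filter fun e => ∃ b ∈ F', g e b := by
    apply Finset.filter_congr
    intro e he
    rw [hcl e he, or_self]
  rw [heq] at hcard
  have h2 := card_le_of_hit (F := F') hg (fun b hb => hit₂ b (hF' hb))
  have h3 : (E.filter fun e => (∃ a, f e a) ∨ ∃ b, g e b).card ≤ E.card :=
    Finset.card_filter_le _ _
  refine ⟨by omega, fun ht => ⟨?_, ?_⟩⟩
  · have h4 : (E.filter fun e => (∃ a, f e a) ∨ ∃ b, g e b) = E :=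
      Finset.eq_of_subset_of_card_le (Finset.filter_subset _ _) (by omega)
    intro e he
    rw [← h4, Finset.mem_filter] at he
    exact he.2
  · have ha : a₀ ∈ F := by
      by_contra hna
      have hcl' : ∀ e ∈ E, (∃ a ∈ insert a₀ F, f e a) ↔ ∃ b ∈ insert b₀ F', g e b := by
        intro e he
        simp only [Finset.mem_insert, or_and_right, exists_or, exists_eq_left]
        rw [hcl e he, hbase e he]
      have := bound _ (Finset.insert_subset ha₀ hF) _ (Finset.insert_subset hb₀ hF') hcl'
      rw [Finset.card_insert_of_notMem hna] at this
      omega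
    intro e he e' he' hea hea'
    have hend : ∀ e ∈ E.filter fun e => ∃ b ∈ F', g e b, ∃ b ∈ F', g e b :=
      fun e he => (Finset.mem_filter.1 he).2
    have hb : b₀ ∈ F' := by
      obtain ⟨b, hb, hgb⟩ := (hcl e he).1 ⟨a₀, ha, hea⟩
      rwa [hg e he _ _ ((hbase e he).1 hea) hgb]
    by_contra hne
    have hlt : F'.card < (E.filter fun e => ∃ b ∈ F', g e b).card := by
      have hmem : e' ∈ E.filter fun e => ∃ b ∈ F', g e b :=
        Finset.mem_filter.2 ⟨he', b₀, hb, (hbase e' he').1 hea'⟩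
      have h5 := card_le_of_hit (E := E.erase e') (F := F') (f := g)
        (fun e he => hg e (Finset.mem_of_mem_erase he)) (fun b hb => by
          by_cases hbb : b = b₀
          · subst hbb
            exact ⟨e, Finset.mem_erase.2 ⟨hne, he⟩, (hbase e he).1 hea⟩
          · obtain ⟨e1, h1, h1'⟩ := hit₂ b (hF' hb)
            refine ⟨e1, Finset.mem_erase.2 ⟨?_, h1⟩, h1'⟩
            rintro rfl
            exact hbb (hg _ he' _ _ h1' ((hbase _ he').1 hea')))
      refine lt_of_le_of_lt h5 (Finset.card_lt_card ?_)
      rw [Finset.ssubset_iff]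
      refine ⟨e', by simp, ?_⟩
      intro e1 h1
      rw [Finset.mem_insert] at h1
      rcases h1 with rfl | h1
      · exact hmem
      · simp only [Finset.mem_filter, Finset.mem_erase] at h1 ⊢
        exact ⟨h1.1.2, h1.2⟩
    omega

end Graph

/-- Images of `D` under the units taking `c` to `y`. -/
def Orb (S : Set (ISemi n)) (c : Fin n) (D : Finset (Fin n)) (y v : Fin n) : Prop :=
  ∃ h, Un S c h ∧ h c = some y ∧ ∃ f ∈ D, h f = some v

theorem Orb.move (hS : IsSubsemigroup S) {c y v y' : Fin n} {D : Finset (Fin n)} {h : ISemi n}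
    (hh : Un S c h) (hy : h y = some y') (ho : Orb S c D y v) :
    ∃ v', h v = some v' ∧ Orb S c D y' v' := by
  obtain ⟨g, hg, hgy, f, hf, hfv⟩ := ho
  obtain ⟨v', hv'⟩ := (hh.dom v).2 ((hg.ran v).1 ⟨f, hfv⟩)
  exact ⟨v', hv', g.trans h, hg.trans hS hh, trans_some hgy hy, f, hf, trans_some hfv hv'⟩

theorem Orb.move' (hS : IsSubsemigroup S) {c y v v' : Fin n} {D : Finset (Fin n)}
    {h : ISemi n}
    (hh : Un S c h) (hv : h v = some v') (ho : Orb S c D y v) :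
    ∃ y', h y = some y' ∧ Orb S c D y' v' := by
  obtain ⟨g, hg, hgy, f, hf, hfv⟩ := ho
  obtain ⟨y', hy'⟩ := (hh.dom y).2 ((hg.ran y).1 ⟨c, hgy⟩)
  exact ⟨y', hy', g.trans h, hg.trans hS hh, trans_some hgy hy', f, hf, trans_some hfv hv⟩

theorem Orb.cell (hS : IsSubsemigroup S) {c y v : Fin n} {D : Finset (Fin n)}
    (hD : ∀ f ∈ D, Cell S c f) (ho : Orb S c D y v) : Cell S c v := by
  obtain ⟨g, hg, -, f, hf, hfv⟩ := ho
  exact hg.cell hS (hD f hf) hfv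

theorem Orb.cell_left (hS : IsSubsemigroup S) {c y v : Fin n} {D : Finset (Fin n)}
    (hcc : Cell S c c) (ho : Orb S c D y v) : Cell S c y := by
  obtain ⟨g, hg, hgy, -⟩ := ho
  exact hg.cell hS hcc hgy

theorem orb_card (hS : IsSubsemigroup S) {c : Fin n} {D : Finset (Fin n)}
    (hcc : Cell S c c) (hD : ∀ f ∈ D, Cell S c f) :
    ∃ k, D.card ≤ k ∧ ∀ y, Cell S c y → (Finset.univ.filter fun v => Orb S c D y v).card = k ∧
      (Finset.univ.filter fun y' => Orb S c D y' y).card = k := by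
  have row_le : ∀ y y', Cell S c y → Cell S c y' → (Finset.univ.filter fun v => Orb S c D y v).card
      ≤ (Finset.univ.filter fun v => Orb S c D y' v).card := by
    intro y y' hy hy'
    obtain ⟨h, hh, hyy⟩ := hy.exists_un hS hy'
    refine card_le_of_map (h := h) fun v hv => ?_
    obtain ⟨v', h1, h2⟩ := (Finset.mem_filter.1 hv).2.move hS hh hyy
    exact ⟨v', by simpa using h2, h1⟩
  have col_le : ∀ y y', Cell S c y → Cell S c y' → (Finset.univ.filter fun v => Orb S c D v y).card
      ≤ (Finset.univ.filter fun v => Orb S c D v y').card := by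
    intro y y' hy hy'
    obtain ⟨h, hh, hyy⟩ := hy.exists_un hS hy'
    refine card_le_of_map (h := h) fun v hv => ?_
    obtain ⟨v', h1, h2⟩ := (Finset.mem_filter.1 hv).2.move' hS hh hyy
    exact ⟨v', by simpa using h2, h1⟩
  refine ⟨_, ?_, fun y hy => ⟨le_antisymm (row_le _ _ hy hcc) (row_le _ _ hcc hy), ?_⟩⟩
  · obtain ⟨e, he, hp, hu⟩ := exists_un_id hS hcc.eqv.1
    apply Finset.card_le_card
    intro f hf
    simp only [Finset.mem_filter, Finset.mem_univ, true_and]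
    exact ⟨e, he, (hu _).2 (Anc.refl _), f, hf, (hu _).2 (hD f hf).anc⟩
  · set C := Finset.univ.filter fun u => Cell S c u with hC
    have hCne : 0 < C.card := Finset.card_pos.2 ⟨c, by simpa [hC] using hcc⟩
    have hdc := Finset.sum_card_bipartiteAbove_eq_sum_card_bipartiteBelow (s := C) (t := C)
      (Orb S c D)
    have h1 : ∀ u ∈ C, (Finset.bipartiteAbove (Orb S c D) C u).card =
        (Finset.univ.filter fun v => Orb S c D c v).card := by
      intro u hu
      have hu' : Cell S c u := by simpa [hC] using hu
      rw [← le_antisymm (row_le _ _ hu' hcc) (row_le _ _ hcc hu')]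
      congr 1
      ext v
      simp only [Finset.mem_bipartiteAbove, hC, Finset.mem_filter, Finset.mem_univ, true_and]
      exact ⟨fun h => h.2, fun h => ⟨h.cell hS hD, h⟩⟩
    have h2 : ∀ u ∈ C, (Finset.bipartiteBelow (Orb S c D) C u).card =
        (Finset.univ.filter fun v => Orb S c D v y).card := by
      intro u hu
      have hu' : Cell S c u := by simpa [hC] using hu
      rw [← le_antisymm (col_le _ _ hu' hy) (col_le _ _ hy hu')]
      congr 1
      ext v
      simp only [Finset.mem_bipartiteBelow, hC, Finset.mem_filter, Finset.mem_univ, true_and]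
      exact ⟨fun h => h.2, fun h => ⟨h.cell_left hS hcc, h⟩⟩
    rw [Finset.sum_congr rfl h1, Finset.sum_congr rfl h2] at hdc
    simp only [Finset.sum_const, smul_eq_mul] at hdc
    exact (Nat.eq_of_mul_eq_mul_left hCne hdc).symm

/-- A simulation relation on the points satisfying `I`. -/
structure Sim (S : Set (ISemi n)) (I : Fin n → Prop) (r : Fin n → Fin n → Prop) : Prop where
  left : ∀ x x', r x x' → I x
  right : ∀ x x', r x x' → I x'
  forward : ∀ x x', r x x' → ∀ θ ∈ S, ∀ y, θ x = some y → I y → ∃ y', θ x' = some y' ∧ r y y'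
  backward : ∀ x x', r x x' → ∀ θ ∈ S, ∀ y, θ y = some x → I y → ∃ y', θ y' = some x' ∧ r y y'

/-- Similarity: the largest simulation. -/
def Le (S : Set (ISemi n)) (I : Fin n → Prop) (x x' : Fin n) : Prop := ∃ r, Sim S I r ∧ r x x'

theorem sim_le (I : Fin n → Prop) : Sim S I (Le S I) where
  left := fun x x' ⟨_, hr, h⟩ => hr.left x x' h
  right := fun x x' ⟨_, hr, h⟩ => hr.right x x' h
  forward := fun x x' ⟨r, hr, h⟩ θ hθ y hy hI =>
    let ⟨y', h1, h2⟩ := hr.forward x x' h θ hθ y hy hI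
    ⟨y', h1, r, hr, h2⟩
  backward := fun x x' ⟨r, hr, h⟩ θ hθ y hy hI =>
    let ⟨y', h1, h2⟩ := hr.backward x x' h θ hθ y hy hI
    ⟨y', h1, r, hr, h2⟩

theorem Le.refl {I : Fin n → Prop} {x : Fin n} (hx : I x) : Le S I x x := by
  refine ⟨fun x y => I x ∧ x = y, ⟨?_, ?_, ?_, ?_⟩, hx, rfl⟩
  · exact fun x x' h => h.1
  · rintro x _ ⟨h, rfl⟩; exact h
  · rintro x _ ⟨h, rfl⟩ θ _ y hy hI; exact ⟨y, hy, hI, rfl⟩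
  · rintro x _ ⟨h, rfl⟩ θ _ y hy hI; exact ⟨y, hy, hI, rfl⟩

theorem Le.trans {I : Fin n → Prop} {x y z : Fin n} (h : Le S I x y) (h' : Le S I y z) :
    Le S I x z := by
  have hs := sim_le (S := S) I
  refine ⟨fun x z => ∃ y, Le S I x y ∧ Le S I y z, ⟨?_, ?_, ?_, ?_⟩, y, h, h'⟩
  · rintro x z ⟨y, h1, -⟩; exact hs.left _ _ h1
  · rintro x z ⟨y, -, h2⟩; exact hs.right _ _ h2
  · rintro x z ⟨y, h1, h2⟩ θ hθ u hu hI
    obtain ⟨v, h3, h4⟩ := hs.forward _ _ h1 θ hθ u hu hI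
    obtain ⟨w, h5, h6⟩ := hs.forward _ _ h2 θ hθ v h3 (hs.right _ _ h4)
    exact ⟨w, h5, v, h4, h6⟩
  · rintro x z ⟨y, h1, h2⟩ θ hθ u hu hI
    obtain ⟨v, h3, h4⟩ := hs.backward _ _ h1 θ hθ u hu hI
    obtain ⟨w, h5, h6⟩ := hs.backward _ _ h2 θ hθ v h3 (hs.right _ _ h4)
    exact ⟨w, h5, v, h4, h6⟩

/-- The points above `x` in the similarity order. -/
noncomputable def up (S : Set (ISemi n)) (I : Fin n → Prop) (x : Fin n) : Finset (Fin n) :=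
  Finset.univ.filter (Le S I x)

theorem mem_up {I : Fin n → Prop} {x y : Fin n} : y ∈ up S I x ↔ Le S I x y := by simp [up]

theorem up_map {I : Fin n → Prop} {x y : Fin n} {θ : ISemi n} (hθ : θ ∈ S) (h : θ x = some y)
    (hx : I x) (hy : I y) :
    (∀ u ∈ up S I x, ∃ v ∈ up S I y, θ u = some v) ∧
      ∀ v ∈ up S I y, ∃ u ∈ up S I x, θ u = some v := by
  have hs := sim_le (S := S) I
  constructor
  · intro u hu
    obtain ⟨v, h1, h2⟩ := hs.forward _ _ (mem_up.1 hu) θ hθ y h hy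
    exact ⟨v, mem_up.2 h2, h1⟩
  · intro u hu
    obtain ⟨v, h1, h2⟩ := hs.backward _ _ (mem_up.1 hu) θ hθ x h hx
    exact ⟨v, mem_up.2 h2, h1⟩

theorem up_card {I : Fin n → Prop} {x y : Fin n} (hxy : STGe S x y) (hx : I x) (hy : I y) :
    (up S I x).card = (up S I y).card := by
  obtain ⟨θ, hθ, h⟩ := hxy
  obtain ⟨h1, h2⟩ := up_map hθ h hx hy
  exact le_antisymm (card_le_of_map h1) (card_le_of_map_symm h2)

theorem stge_total (hst : Semitransitive S) (x y : Fin n) : STGe S x y ∨ STGe S y x := by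
  obtain ⟨f, hf, h | h⟩ := hst x y
  · exact .inl ⟨f, hf, h⟩
  · exact .inr ⟨f, hf, h⟩

theorem stge_refl (hst : Semitransitive S) (x : Fin n) : STGe S x x := by
  rcases stge_total hst x x with h | h <;> exact h

theorem up_card' (hst : Semitransitive S) {I : Fin n → Prop} {x y : Fin n} (hx : I x) (hy : I y) :
    (up S I x).card = (up S I y).card := by
  rcases stge_total hst x y with h | h
  · exact up_card h hx hy
  · exact (up_card h hy hx).symm

theorem up_eq (hst : Semitransitive S) {I : Fin n → Prop} {x y : Fin n} (h : y ∈ up S I x) :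
    up S I y = up S I x := by
  have hs := sim_le (S := S) I
  have h' := mem_up.1 h
  apply Finset.eq_of_subset_of_card_le
  · intro z hz
    exact mem_up.2 (h'.trans (mem_up.1 hz))
  · rw [up_card' hst (hs.left _ _ h') (hs.right _ _ h')]

theorem up_eqv (hS : IsSubsemigroup S) (hst : Semitransitive S) {I : Fin n → Prop} {x y : Fin n}
    (h : y ∈ up S I x) : Eqv S x y := by
  have hs := sim_le (S := S) I
  have h' := mem_up.1 h
  have hx := hs.left _ _ h'
  have hy := hs.right _ _ h'
  have he := up_eq hst h
  rcases stge_total hst x y with hxy | hxy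
  · obtain ⟨θ, hθ, hxy'⟩ := id hxy
    have hm := (up_map hθ hxy' hx hy).1
    rw [he] at hm
    exact ⟨hxy, STGe.of_stable hS hθ (K := up S I x) hm (mem_up.2 (Le.refl hx)) hxy'⟩
  · obtain ⟨θ, hθ, hxy'⟩ := id hxy
    have hm := (up_map hθ hxy' hy hx).1
    rw [he] at hm
    exact ⟨STGe.of_stable hS hθ (K := up S I x) hm h hxy', hxy⟩

/-- The transitivity block of `x`, as a finset. -/
noncomputable def blk (S : Set (ISemi n)) (x : Fin n) : Finset (Fin n) :=
  Finset.univ.filter (Eqv S x)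

theorem mem_blk {x y : Fin n} : y ∈ blk S x ↔ Eqv S x y := by simp [blk]

/-- The points between `a` and `b` in the semitransitivity preorder. -/
def Intv (S : Set (ISemi n)) (a b y : Fin n) : Prop := STGe S a y ∧ STGe S y b

/-- The common size of the sets `up` on an interval. -/
noncomputable def upc (S : Set (ISemi n)) (a b : Fin n) : ℕ := (up S (Intv S a b) a).card

theorem upc_congr (hS : IsSubsemigroup S) (hst : Semitransitive S) {a a' b b' : Fin n}
    (hab : STGe S a b) (ha : Eqv S a a') (hb : Eqv S b b') : upc S a b = upc S a' b' := by
  have hI : Intv S a b = Intv S a' b' := by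
    ext y
    exact ⟨fun h => ⟨ha.2.trans hS h.1, h.2.trans hS hb.1⟩,
      fun h => ⟨ha.1.trans hS h.1, h.2.trans hS hb.2⟩⟩
  unfold upc
  rw [← hI]
  exact up_card' hst ⟨stge_refl hst a, hab⟩ ⟨ha.1, ha.2.trans hS hab⟩

theorem upc_eq (hst : Semitransitive S) {a b y : Fin n} (hab : STGe S a b) (hy : Intv S a b y) :
    upc S a b = (up S (Intv S a b) y).card :=
  up_card' hst ⟨stge_refl hst a, hab⟩ hy

theorem upc_dvd (hS : IsSubsemigroup S) (hst : Semitransitive S) {a b y : Fin n}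
    (hab : STGe S a b) (hy : Intv S a b y) : upc S a b ∣ (blk S y).card := by
  have hI : ∀ z ∈ blk S y, Intv S a b z := by
    intro z hz
    rw [mem_blk] at hz
    exact ⟨hy.1.trans hS hz.1, hz.2.trans hS hy.2⟩
  rw [Finset.card_eq_sum_card_image (up S (Intv S a b)) (blk S y)]
  apply Finset.dvd_sum
  intro s hs
  obtain ⟨z, hz, rfl⟩ := Finset.mem_image.1 hs
  have : (blk S y).filter (fun u => up S (Intv S a b) u = up S (Intv S a b) z) =
      up S (Intv S a b) z := by
    ext u
    simp only [Finset.mem_filter]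
    constructor
    · rintro ⟨hu, he⟩
      rw [← he]
      exact mem_up.2 (Le.refl (hI u hu))
    · intro hu
      exact ⟨mem_blk.2 ((mem_blk.1 hz).trans hS (up_eqv hS hst hu)), up_eq hst hu⟩
  rw [this, upc_eq hst hab (hI z hz)]

theorem upc_le_fix (hS : IsSubsemigroup S) (hst : Semitransitive S) {a b y : Fin n}
    (hab : STGe S a b) (hy : Intv S a b y) {D : Finset (Fin n)}
    (hD : ∀ u, Eqv S y u → Anc S y u → u ∈ D) : upc S a b ≤ D.card := by
  rw [upc_eq hst hab hy]
  apply Finset.card_le_card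
  intro u hu
  refine hD u (up_eqv hS hst hu) fun e he hp hey => ?_
  obtain ⟨u', h, -⟩ := (sim_le (S := S) (Intv S a b)).forward _ _ (mem_up.1 hu) e he y hey hy
  have := hp _ _ h
  rwa [← this] at h

/-- Some map from a top point `a` into `Q` meets `Q` only from the top block. -/
theorem exists_top_preimage (hS : IsSubsemigroup S) {a : Fin n} (ha : ∀ u, STGe S a u)
    {Q : Fin n → Prop} {b : Fin n} (hb : Q b) :
    ∃ θ ∈ S, ∃ v, Q v ∧ θ a = some v ∧ ∀ u y, θ u = some y → Q y → Eqv S a u := by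
  let c : Fin n → ℕ := fun u => (Finset.univ.filter fun v => ¬ STGe S u v).card
  let cost : ISemi n → ℕ := fun θ => ∑ q ∈ Finset.univ.filter Q, (θ.symm q).elim 0 c
  obtain ⟨θ, ⟨hθ, v, hv, hav⟩, hmin⟩ :=
    Set.exists_min_image {θ : ISemi n | θ ∈ S ∧ ∃ v, Q v ∧ θ a = some v} cost (Set.toFinite _)
      (by obtain ⟨θ, hθ, h⟩ := ha b; exact ⟨θ, hθ, b, hb, h⟩)
  refine ⟨θ, hθ, v, hv, hav, fun u y huy hy => ⟨ha u, ?_⟩⟩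
  obtain ⟨σ, hσ, hau⟩ := ha u
  have hc : ∀ {u u'}, STGe S u u' → c u ≤ c u' := by
    intro u u' h
    apply Finset.card_le_card
    intro w hw
    simp only [Finset.mem_filter, Finset.mem_univ, true_and] at hw ⊢
    exact fun h' => hw (h.trans hS h')
  have hle : ∀ q ∈ Finset.univ.filter Q,
      ((σ.trans θ).symm q).elim 0 c ≤ (θ.symm q).elim 0 c := by
    intro q _
    cases h : (σ.trans θ).symm q with
    | none => simp
    | some u' =>
      rw [PEquiv.eq_some_iff, PEquiv.trans_eq_some] at h
      obtain ⟨w, h1, h2⟩ := h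
      rw [(PEquiv.eq_some_iff θ).2 h2]
      exact hc ⟨σ, hσ, h1⟩
  have heq := (Finset.sum_eq_sum_iff_of_le hle).1
    (le_antisymm (Finset.sum_le_sum hle)
      (hmin _ ⟨hS _ hσ _ hθ, y, hy, trans_some hau huy⟩)) y (by simpa using hy)
  rw [(PEquiv.eq_some_iff (σ.trans θ)).2 (trans_some hau huy), (PEquiv.eq_some_iff θ).2 huy] at heq
  have h0 : c u = 0 := by
    change c a = c u at heq
    rw [← heq]
    simpa [c] using ha
  rw [Finset.card_eq_zero, Finset.filter_eq_empty_iff] at h0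
  exact not_not.1 (h0 (Finset.mem_univ a))

/-- Closed pairs have size at most `upc`. -/
theorem closed_pair_card_le (hS : IsSubsemigroup S) {a b : Fin n}
    (ha : ∀ u, STGe S a u) (hP : ∀ u, Eqv S a u → Cell S a u) (hbb : Cell S b b)
    {F F' : Finset (Fin n)} (hF : ∀ f ∈ F, Cell S b f)
    (hcl : ∀ θ ∈ S, (∃ f ∈ F, θ a = some f) ↔ ∃ u ∈ F', θ u = some b) :
    F.card ≤ upc S a b := by
  have haa : Cell S a a := hP a ⟨ha a, ha a⟩
  set D := F'.filter (Eqv S a) with hDdef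
  have hD : ∀ f ∈ D, Cell S a f := fun f hf => hP f (Finset.mem_filter.1 hf).2
  obtain ⟨kQ, hkQF, hkQ⟩ := orb_card hS hbb hF
  obtain ⟨kP, hkPD, hkP⟩ := orb_card hS haa hD
  have h3 : ∀ u y, Cell S b y → ∀ θ ∈ S, θ u = some y → ∀ x, Orb S a D x u →
      ∃ v, θ x = some v ∧ Orb S b F y v := by
    intro u y hy θ hθ huy x ⟨h, hh, hax, d, hd, hdu⟩
    obtain ⟨τ, hτ, hyb⟩ := hy.exists_un hS hbb
    obtain ⟨f, hf, haf⟩ := (hcl ((h.trans θ).trans τ) (hS _ (hS _ hh.mem _ hθ) _ hτ.mem)).2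
      ⟨d, (Finset.mem_filter.1 hd).1, trans_some (trans_some hdu huy) hyb⟩
    obtain ⟨v, h1, h2⟩ := (PEquiv.trans_eq_some _ _ _ _).1 haf
    obtain ⟨w, h4, h5⟩ := (PEquiv.trans_eq_some _ _ _ _).1 h1
    rw [hax] at h4
    cases h4
    exact ⟨v, h5, τ.symm, hτ.symm, (PEquiv.eq_some_iff _).2 hyb, f, hf, (PEquiv.eq_some_iff _).2 h2⟩
  have hPQ : kP ≤ kQ := by
    obtain ⟨θ, hθ, hab⟩ := ha b
    rw [← (hkP a haa).2, ← (hkQ b hbb).1]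
    refine card_le_of_map (h := θ) fun x hx => ?_
    obtain ⟨v, h1, h2⟩ := h3 a b hbb θ hθ hab x (by simpa using hx)
    exact ⟨v, by simpa using h2, h1⟩
  have hQP : kQ ≤ kP := by
    obtain ⟨θ, hθ, v, hv, hav, hpre⟩ := exists_top_preimage hS ha (Q := Cell S b) hbb
    rw [← (hkQ v hv).2]
    refine le_trans (card_le_of_map_symm (h := θ) fun y hy => ?_) hkPD
    have hy' : Orb S b F y v := by simpa using hy
    obtain ⟨h, hh, hby, f, hf, hfv⟩ := id hy'
    obtain ⟨u, hu, hub⟩ := (hcl (θ.trans h.symm) (hS _ hθ _ hh.symm_mem)).1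
      ⟨f, hf, trans_some hav ((PEquiv.eq_some_iff _).2 hfv)⟩
    obtain ⟨w, h1, h2⟩ := (PEquiv.trans_eq_some _ _ _ _).1 hub
    rw [PEquiv.eq_some_iff, hby] at h2
    cases h2
    exact ⟨u, Finset.mem_filter.2 ⟨hu, hpre u y h1 (hy'.cell_left hS hbb)⟩, h1⟩
  have hk : kP = kQ := le_antisymm hPQ hQP
  have h4 : ∀ u y, Cell S a u → Cell S b y → ∀ θ ∈ S, θ u = some y → ∀ v, Orb S b F y v →
      ∃ x, Orb S a D x u ∧ θ x = some v := by
    intro u y hu hy θ hθ huy v hv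
    have := surj_of_map (h := θ) (A := Finset.univ.filter fun x => Orb S a D x u)
      (B := Finset.univ.filter fun v => Orb S b F y v) (fun x hx => by
        obtain ⟨v, h1, h2⟩ := h3 u y hy θ hθ huy x (by simpa using hx)
        exact ⟨v, by simpa using h2, h1⟩) (by rw [(hkP u hu).2, (hkQ y hy).1, hk])
    obtain ⟨x, hx, hxv⟩ := this v (by simpa using hv)
    exact ⟨x, by simpa using hx, hxv⟩
  have hab := ha b
  refine hkQF.trans ?_
  rw [← hk, ← (hkP a haa).2]
  apply Finset.card_le_card
  intro x hx
  have hx' : Orb S a D x a := by simpa using hx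
  rw [mem_up]
  refine ⟨fun x x' => Intv S a b x ∧ ∃ a₁ a₁', ∃ σ ∈ S, Cell S a a₁ ∧ σ a₁ = some x ∧
    Orb S a D a₁' a₁ ∧ σ a₁' = some x', ⟨?_, ?_, ?_, ?_⟩, ?_⟩
  · exact fun x x' h => h.1
  · rintro x x' ⟨hI, a₁, a₁', σ, hσ, h1, h2, h5, h6⟩
    obtain ⟨τ, hτ, hxb⟩ := hI.2
    obtain ⟨v, h7, h8⟩ := h3 a₁ b hbb (σ.trans τ) (hS _ hσ _ hτ) (trans_some h2 hxb) a₁' h5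
    obtain ⟨w, h9, h10⟩ := (PEquiv.trans_eq_some _ _ _ _).1 h7
    rw [h6] at h9
    cases h9
    exact ⟨ha x', STGe.trans hS ⟨τ, hτ, h10⟩ (h8.cell hS hF).eqv.2⟩
  · rintro x x' ⟨hI, a₁, a₁', σ, hσ, h1, h2, h5, h6⟩ θ hθ y hxy hIy
    obtain ⟨τ, hτ, hyb⟩ := hIy.2
    obtain ⟨v, h7, -⟩ := h3 a₁ b hbb ((σ.trans θ).trans τ) (hS _ (hS _ hσ _ hθ) _ hτ)
      (trans_some (trans_some h2 hxy) hyb) a₁' h5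
    obtain ⟨y', h9, -⟩ := (PEquiv.trans_eq_some _ _ _ _).1 h7
    obtain ⟨w, h10, h11⟩ := (PEquiv.trans_eq_some _ _ _ _).1 h9
    rw [h6] at h10
    cases h10
    exact ⟨y', h11, hIy, a₁, a₁', σ.trans θ, hS _ hσ _ hθ, h1, trans_some h2 hxy, h5, h9⟩
  · rintro x x' ⟨hI, a₁, a₁', σ, hσ, h1, h2, h5, h6⟩ θ hθ y hyx hIy
    obtain ⟨τ, hτ, hxb⟩ := hI.2
    obtain ⟨σ₂, hσ₂, hay⟩ := hIy.1
    obtain ⟨v, h7, h8⟩ := h3 a₁ b hbb (σ.trans τ) (hS _ hσ _ hτ) (trans_some h2 hxb) a₁' h5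
    obtain ⟨w, h9, h10⟩ := (PEquiv.trans_eq_some _ _ _ _).1 h7
    rw [h6] at h9
    cases h9
    obtain ⟨a₂', h11, h12⟩ := h4 a b haa hbb ((σ₂.trans θ).trans τ) (hS _ (hS _ hσ₂ _ hθ) _ hτ)
      (trans_some (trans_some hay hyx) hxb) v h8
    obtain ⟨x'', h13, h14⟩ := (PEquiv.trans_eq_some _ _ _ _).1 h12
    have := peInj h10 h14
    subst this
    obtain ⟨y', h15, h16⟩ := (PEquiv.trans_eq_some _ _ _ _).1 h13
    exact ⟨y', h16, hIy, a, a₂', σ₂, hσ₂, haa, hay, h11, h15⟩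
  · obtain ⟨e, he, hp, hu⟩ := exists_un_id hS haa.eqv.1
    exact ⟨⟨ha a, hab⟩, a, x, e, he.mem, haa, (hu a).2 haa.anc, hx',
      (hu x).2 (hx'.cell_left hS haa).anc⟩

/-- The opposite semigroup, consisting of the inverse maps. -/
def Op (S : Set (ISemi n)) : Set (ISemi n) := {φ | φ.symm ∈ S}

theorem op_sub (hS : IsSubsemigroup S) : IsSubsemigroup (Op S) := by
  intro a ha b hb
  change (a.trans b).symm ∈ S
  rw [PEquiv.symm_trans_rev]
  exact hS _ hb _ ha

theorem op_stge {x y : Fin n} : STGe (Op S) x y ↔ STGe S y x := by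
  constructor
  · rintro ⟨φ, hφ, h⟩
    exact ⟨φ.symm, hφ, (PEquiv.eq_some_iff _).2 h⟩
  · rintro ⟨φ, hφ, h⟩
    exact ⟨φ.symm, by simpa [Op] using hφ, (PEquiv.eq_some_iff _).2 h⟩

theorem op_st (hst : Semitransitive S) : Semitransitive (Op S) := by
  intro x y
  rcases stge_total hst x y with h | h
  · obtain ⟨φ, hφ, h⟩ := op_stge.2 h
    exact ⟨φ, hφ, .inr h⟩
  · obtain ⟨φ, hφ, h⟩ := op_stge.2 h
    exact ⟨φ, hφ, .inl h⟩

theorem op_eqv {x y : Fin n} : Eqv (Op S) x y ↔ Eqv S x y := by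
  unfold Eqv
  rw [op_stge, op_stge, and_comm]

theorem op_blk {x : Fin n} : blk (Op S) x = blk S x := by
  ext y
  rw [mem_blk, mem_blk, op_eqv]

theorem Pid.symm_eq {e : ISemi n} (he : Pid e) : e.symm = e := by
  ext u v
  constructor
  · intro h
    have h' := (PEquiv.eq_some_iff e).1 h
    have := he _ _ h'
    subst this
    exact h'
  · intro h
    have := he _ _ h
    subst this
    exact (PEquiv.eq_some_iff e).2 h

theorem op_anc {x y : Fin n} : Anc (Op S) x y ↔ Anc S x y := by
  have : ∀ e, Pid e → (e ∈ Op S ↔ e ∈ S) := fun e he => by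
    change e.symm ∈ S ↔ _
    rw [he.symm_eq]
  exact ⟨fun h e he hp hx => h e ((this e hp).2 he) hp hx,
    fun h e he hp hx => h e ((this e hp).1 he) hp hx⟩

theorem op_cell {x y : Fin n} : Cell (Op S) x y ↔ Cell S x y :=
  ⟨fun h => ⟨op_eqv.1 h.eqv, op_anc.1 h.anc, op_anc.1 h.anc'⟩,
    fun h => ⟨op_eqv.2 h.eqv, op_anc.2 h.anc, op_anc.2 h.anc'⟩⟩

/-- The nonzero elements of `S`. -/
noncomputable def Nz (S : Set (ISemi n)) : Finset (ISemi n) :=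
  (Set.toFinite {θ | θ ∈ S ∧ ∃ u v, θ u = some v}).toFinset

theorem mem_nz {θ : ISemi n} : θ ∈ Nz S ↔ θ ∈ S ∧ ∃ u v, θ u = some v := by simp [Nz]

theorem op_nz : (Nz (Op S)).card = (Nz S).card := by
  refine Finset.card_bij' (fun θ _ => θ.symm) (fun θ _ => θ.symm) ?_ ?_ ?_ ?_
  · intro θ h
    obtain ⟨h1, u, v, h2⟩ := mem_nz.1 h
    exact mem_nz.2 ⟨h1, v, u, (PEquiv.eq_some_iff _).2 h2⟩
  · intro θ h
    obtain ⟨h1, u, v, h2⟩ := mem_nz.1 h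
    exact mem_nz.2 ⟨by simpa [Op] using h1, v, u, (PEquiv.eq_some_iff _).2 h2⟩
  · intro θ _; simp
  · intro θ _; simp

theorem exists_zero (hS : IsSubsemigroup S) (hst : Semitransitive S)
    (hsing : ∀ φ ∈ S, IsSingular φ) (hn : 0 < n) : ∃ φ ∈ S, ∀ u, φ u = none := by
  let rk : ISemi n → ℕ := fun φ => (Finset.univ.filter fun u => (φ u).isSome).card
  have hne : S.Nonempty := by
    obtain ⟨φ, hφ, -⟩ := hst ⟨0, hn⟩ ⟨0, hn⟩
    exact ⟨φ, hφ⟩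
  obtain ⟨φ, hφ, hmin⟩ := Set.exists_min_image S rk (Set.toFinite _) hne
  obtain ⟨k, hk⟩ := exists_pid_pow φ
  set e := pePow φ (k + 2) with he
  have heS : e ∈ S := pePow_mem hS hφ (k + 1)
  have hle : rk e ≤ rk φ := by
    apply Finset.card_le_card
    intro u hu
    simp only [Finset.mem_filter, Finset.mem_univ, true_and] at hu ⊢
    obtain ⟨v, hv⟩ := Option.isSome_iff_exists.1 hu
    rw [he, show k + 2 = 1 + (k + 1) by ring, pePow_add, pePow_one, PEquiv.trans_eq_some] at hv
    obtain ⟨w, h, -⟩ := hv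
    simp [h]
  have hstab : ∀ σ ∈ S, ∀ u ∈ {u | e u = some u}, ∃ v ∈ {u | e u = some u}, σ u = some v := by
    intro σ hσ u hu
    set g := (e.trans σ).trans e with hg
    have hgS : g ∈ S := hS _ (hS _ heS _ hσ) _ heS
    have hsub : (Finset.univ.filter fun u => (g u).isSome) ⊆
        Finset.univ.filter fun u => (e u).isSome := by
      intro u hu
      simp only [Finset.mem_filter, Finset.mem_univ, true_and] at hu ⊢
      obtain ⟨v, hv⟩ := Option.isSome_iff_exists.1 hu
      obtain ⟨w, h1, -⟩ := (PEquiv.trans_eq_some _ _ _ _).1 hv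
      obtain ⟨w', h3, -⟩ := (PEquiv.trans_eq_some _ _ _ _).1 h1
      simp [h3]
    have heq := Finset.eq_of_subset_of_card_le hsub (hle.trans (hmin g hgS))
    have hmem : u ∈ Finset.univ.filter fun u => (g u).isSome := by
      rw [heq]
      simp [show e u = some u from hu]
    simp only [Finset.mem_filter, Finset.mem_univ, true_and] at hmem
    obtain ⟨v, hv⟩ := Option.isSome_iff_exists.1 hmem
    obtain ⟨w, h1, h2⟩ := (PEquiv.trans_eq_some _ _ _ _).1 hv
    obtain ⟨w', h3, h4⟩ := (PEquiv.trans_eq_some _ _ _ _).1 h1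
    have := hk _ _ h2
    subst this
    have := hk _ _ h3
    subst this
    exact ⟨w, h2, h4⟩
  refine ⟨e, heS, fun u => ?_⟩
  by_contra hu
  obtain ⟨v, hv⟩ := Option.ne_none_iff_exists'.1 hu
  have := hk _ _ hv
  subst this
  obtain ⟨y, hy⟩ := hsing e heS
  obtain ⟨σ, hσ, h | h⟩ := hst u y
  · obtain ⟨y', hy', h'⟩ := hstab σ hσ u hv
    rw [h] at h'
    cases h'
    rw [Set.mem_ofPred_eq, hy] at hy'
    cases hy'
  · obtain ⟨u', hu', h'⟩ := surj_of_stable (hstab σ hσ) (v := u) hv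
    have := peInj h h'
    subst this
    rw [Set.mem_ofPred_eq, hy] at hu'
    cases hu'

theorem ncard_eq (hS : IsSubsemigroup S) (hst : Semitransitive S)
    (hsing : ∀ φ ∈ S, IsSingular φ) (hn : 0 < n) : S.ncard = (Nz S).card + 1 := by
  obtain ⟨φ, hφ, h0⟩ := exists_zero hS hst hsing hn
  have hnot : φ ∉ Nz S := by
    rw [mem_nz]
    rintro ⟨-, u, v, h⟩
    rw [h0] at h
    cases h
  have : S = ((insert φ (Nz S) : Finset (ISemi n)) : Set (ISemi n)) := by
    ext θ
    rw [Finset.coe_insert, Set.mem_insert_iff, Finset.mem_coe, mem_nz]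
    constructor
    · intro hθ
      by_cases h : ∃ u v, θ u = some v
      · exact .inr ⟨hθ, h⟩
      · left
        push Not at h
        ext u v
        simp [h u, h0 u]
    · rintro (rfl | h)
      · exact hφ
      · exact h.1
  have h := congrArg Set.ncard this
  rwa [Set.ncard_coe_finset, Finset.card_insert_of_notMem hnot] at h

theorem card_le_of_reach {E : Finset (ISemi n)} {D : Finset (Fin n)} {x : Fin n}
    (h : ∀ y ∈ D, ∃ θ ∈ E, θ x = some y) : D.card ≤ E.card := by
  have : Nonempty (ISemi n) := ⟨PEquiv.refl _⟩
  choose! φ hφ hφ' using h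
  refine Finset.card_le_card_of_injOn φ hφ fun y hy y' hy' he => ?_
  have h1 := hφ' y hy
  rw [he, hφ' y' hy'] at h1
  exact (Option.some.inj h1).symm

theorem reach_of_card_le {E : Finset (ISemi n)} {D : Finset (Fin n)} {x : Fin n}
    (h : ∀ y ∈ D, ∃ θ ∈ E, θ x = some y) (hc : E.card ≤ D.card) :
    (∀ θ ∈ E, ∃ y, θ x = some y) ∧
      ∀ θ ∈ E, ∀ θ' ∈ E, ∀ y, θ x = some y → θ' x = some y → θ = θ' := by
  have : Nonempty (ISemi n) := ⟨PEquiv.refl _⟩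
  choose! φ hφ hφ' using h
  have hinj : Set.InjOn φ D := by
    intro y hy y' hy' he
    have h1 := hφ' y hy
    rw [he, hφ' y' hy'] at h1
    exact (Option.some.inj h1).symm
  have hsurj : ∀ θ ∈ E, ∃ y ∈ D, φ y = θ := fun θ hθ =>
    Finset.surjOn_of_injOn_of_card_le φ hφ hinj hc hθ
  refine ⟨fun θ hθ => ?_, fun θ hθ θ' hθ' y h1 h2 => ?_⟩
  · obtain ⟨y, hy, rfl⟩ := hsurj θ hθ
    exact ⟨y, hφ' y hy⟩
  · obtain ⟨y1, hy1, rfl⟩ := hsurj θ hθ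
    obtain ⟨y2, hy2, rfl⟩ := hsurj θ' hθ'
    rw [hφ' y1 hy1] at h1
    rw [hφ' y2 hy2] at h2
    rw [Option.some.inj h1, Option.some.inj h2]

theorem exists_highest (hS : IsSubsemigroup S) (hst : Semitransitive S) {s : Set (Fin n)}
    (hs : s.Nonempty) : ∃ w ∈ s, ∀ u ∈ s, STGe S w u := by
  obtain ⟨w, hw, hmax⟩ := Set.exists_max_image s
    (fun w => (Finset.univ.filter fun v => STGe S w v).card) (Set.toFinite _) hs
  refine ⟨w, hw, fun u hu => ?_⟩
  rcases stge_total hst w u with h | h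
  · exact h
  · have hsub : (Finset.univ.filter fun v => STGe S w v) ⊆ Finset.univ.filter fun v => STGe S u v := by
      intro v hv
      simp only [Finset.mem_filter, Finset.mem_univ, true_and] at hv ⊢
      exact h.trans hS hv
    have heq := Finset.eq_of_subset_of_card_le hsub (hmax u hu)
    have : u ∈ Finset.univ.filter fun v => STGe S w v := by
      rw [heq]
      simpa using stge_refl hst u
    simpa using this

theorem top_cell (hS : IsSubsemigroup S) (hst : Semitransitive S) (hN : (Nz S).card < 2 * n)
    {x y : Fin n} (hx : ∀ u, STGe S x u) (hy : Eqv S x y) : Cell S x y := by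
  have key : ∀ {x y : Fin n}, (∀ u, STGe S x u) → Eqv S x y → Anc S x y := by
    intro x y hx hy
    by_contra hcon
    have h1 : (Finset.univ : Finset (Fin n)).card ≤ ((Nz S).filter fun θ => θ y = none).card := by
      refine card_le_of_reach (x := x) fun u _ => ?_
      obtain ⟨θ, hθ, hu⟩ := hx u
      obtain ⟨t, ht, h⟩ := exists_left hS (stge_refl hst x) hθ
      have htu := (h x u).2 ⟨hu, Anc.refl _⟩
      refine ⟨t, Finset.mem_filter.2 ⟨mem_nz.2 ⟨ht, x, u, htu⟩, ?_⟩, htu⟩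
      by_contra hne
      obtain ⟨v, hv⟩ := Option.ne_none_iff_exists'.1 hne
      exact hcon ((h _ _).1 hv).2
    have h2 : (Finset.univ : Finset (Fin n)).card ≤
        ((Nz S).filter fun θ => ¬ θ y = none).card := by
      refine card_le_of_reach (x := y) fun u _ => ?_
      obtain ⟨θ, hθ, hu⟩ := hy.2.trans hS (hx u)
      exact ⟨θ, Finset.mem_filter.2 ⟨mem_nz.2 ⟨hθ, y, u, hu⟩, by simp [hu]⟩, hu⟩
    have h3 := Finset.card_filter_add_card_filter_not (s := Nz S) (fun θ => θ y = none)
    rw [Finset.card_univ, Fintype.card_fin] at h1 h2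
    omega
  exact ⟨hy, key hx hy, key (fun u => hy.2.trans hS (hx u)) hy.symm⟩

theorem exists_not_anc (hS : IsSubsemigroup S) (hst : Semitransitive S)
    (hsing : ∀ φ ∈ S, IsSingular φ) (x : Fin n) : ∃ u, ¬ Anc S x u := by
  obtain ⟨e, he, -, h⟩ := exists_least hS (stge_refl hst x)
  obtain ⟨u, hu⟩ := hsing e he
  refine ⟨u, fun hA => ?_⟩
  rw [(h u).2 hA] at hu
  cases hu

/-- A top point `x`, a bottom point `z` and a highest point `w` outside the least partial identity
of `x`, in a small semitransitive semigroup. -/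
structure Config (S : Set (ISemi n)) (x z w : Fin n) : Prop where
  sub : IsSubsemigroup S
  st : Semitransitive S
  small : (Nz S).card < 2 * n
  top : ∀ u, STGe S x u
  bot : ∀ u, STGe S u z
  topCell : ∀ u, Eqv S x u → Cell S x u
  botCell : ∀ u, Eqv S z u → Cell S z u
  notMem : ¬ Anc S x w
  highest : ∀ u, ¬ Anc S x u → STGe S w u

/-- The nonzero maps with domain inside the least partial identity of `x`. -/
noncomputable def Lo (S : Set (ISemi n)) (x : Fin n) : Finset (ISemi n) :=
  (Nz S).filter fun θ => ∀ u v, θ u = some v → Anc S x u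

/-- The nonzero maps with domain not inside the least partial identity of `x`. -/
noncomputable def Hi (S : Set (ISemi n)) (x : Fin n) : Finset (ISemi n) :=
  (Nz S).filter fun θ => ¬ ∀ u v, θ u = some v → Anc S x u

theorem lo_add_hi (x : Fin n) : (Lo S x).card + (Hi S x).card = (Nz S).card :=
  Finset.card_filter_add_card_filter_not _

theorem mem_lo {x : Fin n} {θ : ISemi n} (hθ : θ ∈ S) {u v : Fin n} (h : θ u = some v)
    (hd : ∀ u v, θ u = some v → Anc S x u) : θ ∈ Lo S x :=
  Finset.mem_filter.2 ⟨mem_nz.2 ⟨hθ, u, v, h⟩, hd⟩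

theorem mem_hi {x : Fin n} {θ : ISemi n} (hθ : θ ∈ S) {u v : Fin n} (h : θ u = some v)
    (hd : ¬ Anc S x u) : θ ∈ Hi S x :=
  Finset.mem_filter.2 ⟨mem_nz.2 ⟨hθ, u, v, h⟩, fun H => hd (H _ _ h)⟩

theorem Lo.mem {x : Fin n} {θ : ISemi n} (h : θ ∈ Lo S x) : θ ∈ S :=
  (mem_nz.1 (Finset.mem_filter.1 h).1).1

theorem Lo.dom {x : Fin n} {θ : ISemi n} (h : θ ∈ Lo S x) {u v : Fin n} (huv : θ u = some v) :
    Anc S x u :=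
  (Finset.mem_filter.1 h).2 u v huv

theorem Hi.mem {x : Fin n} {θ : ISemi n} (h : θ ∈ Hi S x) : θ ∈ S :=
  (mem_nz.1 (Finset.mem_filter.1 h).1).1

/-- The points of the least partial identity of `x` above `w`. -/
noncomputable def Above (S : Set (ISemi n)) (x w : Fin n) : Finset (Fin n) :=
  Finset.univ.filter fun y => Anc S x y ∧ STGe S y w

/-- The points below `w`. -/
noncomputable def Below (S : Set (ISemi n)) (w : Fin n) : Finset (Fin n) :=
  Finset.univ.filter fun y => STGe S w y

theorem mem_above {x w y : Fin n} : y ∈ Above S x w ↔ Anc S x y ∧ STGe S y w := by simp [Above]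

theorem mem_below {w y : Fin n} : y ∈ Below S w ↔ STGe S w y := by simp [Below]

namespace Config

variable {x z w : Fin n}

theorem refl (s : Config S x z w) (u : Fin n) : STGe S u u := stge_refl s.st u

theorem exists_to_lo (s : Config S x z w) {θ : ISemi n} (hθ : θ ∈ S) :
    ∃ t ∈ S, (∀ u v, t u = some v ↔ θ u = some v ∧ Anc S x u) ∧
      ∀ u v, t u = some v → t ∈ Lo S x := by
  obtain ⟨t, ht, h⟩ := exists_left s.sub (s.refl x) hθ
  exact ⟨t, ht, h, fun u v huv => mem_lo ht huv fun u v huv => ((h u v).1 huv).2⟩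

theorem closed_in_cell (s : Config S x z w) {F F' : Finset (Fin n)}
    (hcl : ∀ θ ∈ S, (∃ a ∈ F, θ x = some a) ↔ ∃ b ∈ F', θ b = some w) :
    ∀ f ∈ F, Cell S w f := by
  have hS := s.sub
  intro y hy
  obtain ⟨σ, hσ, hxy⟩ := s.top y
  have h1 : Anc S y w := by
    obtain ⟨t, ht, h⟩ := exists_right hS (s.refl y) hσ
    obtain ⟨u, -, hu⟩ := (hcl t ht).1 ⟨y, hy, (h _ _).2 ⟨hxy, Anc.refl _⟩⟩
    exact ((h _ _).1 hu).2
  have h2 : Anc S w y := by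
    obtain ⟨t, ht, h⟩ := exists_right hS (s.refl w) hσ
    obtain ⟨u, hu, huw⟩ := (hcl σ hσ).1 ⟨y, hy, hxy⟩
    obtain ⟨f, -, hf⟩ := (hcl t ht).2 ⟨u, hu, (h _ _).2 ⟨huw, Anc.refl _⟩⟩
    obtain ⟨h3, h4⟩ := (h _ _).1 hf
    rw [hxy] at h3
    cases h3
    exact h4
  have h3 : STGe S w y := s.highest y fun h => s.notMem (h.trans h1)
  refine ⟨⟨h3, ?_⟩, h2, h1⟩
  by_contra hcon
  obtain ⟨ψ', hψ', hwy'⟩ := h3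
  obtain ⟨ψ, hψ, hψc⟩ := exists_corner hS (s.refl w) hψ'
  have hwy := (hψc _ _).2 ⟨hwy', Anc.refl _, h2⟩
  obtain ⟨σ', hσ', hxw'⟩ := s.top w
  obtain ⟨σ, hσ, hσl⟩ := exists_left hS (s.refl x) hσ'
  have hxw := (hσl _ _).2 ⟨hxw', Anc.refl _⟩
  obtain ⟨y', hy', hyw⟩ := (hcl (σ.trans ψ) (hS _ hσ _ hψ)).1 ⟨y, hy, trans_some hxw hwy⟩
  obtain ⟨u, hu, huw⟩ := (PEquiv.trans_eq_some _ _ _ _).1 hyw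
  by_cases hA : Anc S x u
  · obtain ⟨τ, hτ, hτr⟩ := exists_right hS (s.refl u) hσ
    obtain ⟨f, -, hf⟩ := (hcl (τ.trans ψ) (hS _ hτ _ hψ)).2
      ⟨y', hy', trans_some ((hτr _ _).2 ⟨hu, Anc.refl _⟩) huw⟩
    obtain ⟨v, h4, -⟩ := (PEquiv.trans_eq_some _ _ _ _).1 hf
    obtain ⟨h5, h6⟩ := (hτr _ _).1 h4
    rw [hxw] at h5
    cases h5
    exact s.notMem (hA.trans h6)
  · obtain ⟨ρ', hρ', hwu'⟩ := s.highest u hA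
    obtain ⟨ρ, hρ, hρc⟩ := exists_corner hS (s.refl w) hρ'
    have hwu := (hρc _ _).2 ⟨hwu', Anc.refl _, ((hψc _ _).1 huw).2.1⟩
    have hun := (un_of_fix hS hρ hψ (fun u v h => ((hρc _ _).1 h).2)
      (fun u v h => ((hψc _ _).1 h).2) (trans_some hwu huw)).2
    exact hcon ⟨ψ.symm, hun.symm_mem, (PEquiv.eq_some_iff _).2 hwy⟩

theorem lo_tight (s : Config S x z w) :
    n + (Above S x w).card ≤ (Lo S x).card + upc S x w ∧
      ((Lo S x).card + upc S x w ≤ n + (Above S x w).card →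
        (∀ θ ∈ Lo S x, (∃ a, θ x = some a) ∨ ∃ b, θ b = some w) ∧
        ∀ θ ∈ Lo S x, ∀ θ' ∈ Lo S x, θ x = some w → θ' x = some w → θ = θ') := by
  have key := graph_tight (E := Lo S x) (V₁ := (Finset.univ : Finset (Fin n))) (V₂ := Above S x w)
    (f := fun θ y => θ x = some y) (g := fun θ u => θ u = some w) (t := upc S x w) (a₀ := w)
    (b₀ := x) (fun θ _ a a' h h' => by rw [h] at h'; exact Option.some.inj h')
    (fun θ _ b b' h h' => peInj h h') (fun _ _ _ _ => Finset.mem_univ _)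
    (fun θ hθ b h => mem_above.2 ⟨Lo.dom hθ h, θ, Lo.mem hθ, h⟩)
    (fun b hb => by
      obtain ⟨hA, θ, hθ, h⟩ := mem_above.1 hb
      obtain ⟨t, -, h1, h2⟩ := s.exists_to_lo hθ
      have h3 := (h1 b w).2 ⟨h, hA⟩
      exact ⟨t, h2 _ _ h3, h3⟩)
    (Finset.mem_univ _) (mem_above.2 ⟨Anc.refl x, s.top w⟩) (fun _ _ => Iff.rfl)
    (fun F _ F' hF' hcl => by
      have hcl' : ∀ θ ∈ S, (∃ a ∈ F, θ x = some a) ↔ ∃ b ∈ F', θ b = some w := by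
        intro θ hθ
        obtain ⟨t, -, h1, h2⟩ := s.exists_to_lo hθ
        constructor
        · rintro ⟨a, ha, hxa⟩
          have h3 := (h1 x a).2 ⟨hxa, Anc.refl x⟩
          obtain ⟨b, hb, hbw⟩ := (hcl t (h2 _ _ h3)).1 ⟨a, ha, h3⟩
          exact ⟨b, hb, ((h1 _ _).1 hbw).1⟩
        · rintro ⟨b, hb, hbw⟩
          have h3 := (h1 b w).2 ⟨hbw, (mem_above.1 (hF' hb)).1⟩
          obtain ⟨a, ha, hxa⟩ := (hcl t (h2 _ _ h3)).2 ⟨b, hb, h3⟩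
          exact ⟨a, ha, ((h1 _ _).1 hxa).1⟩
      exact closed_pair_card_le s.sub s.top s.topCell ⟨⟨s.refl w, s.refl w⟩, Anc.refl w, Anc.refl w⟩
        (s.closed_in_cell hcl') hcl')
  rwa [Finset.card_univ, Fintype.card_fin] at key

theorem reach_hi (s : Config S x z w) {v : Fin n} (hv : Eqv S w v) (hA : ¬ Anc S x v) :
    ∀ y ∈ Below S w, ∃ θ ∈ Hi S x, θ v = some y := by
  intro y hy
  obtain ⟨θ, hθ, h⟩ := hv.2.trans s.sub (mem_below.1 hy)
  exact ⟨θ, mem_hi hθ h hA, h⟩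

theorem intv_w (s : Config S x z w) {v : Fin n} (hv : Eqv S w v) : Intv S x w v := ⟨s.top v, hv.2⟩

theorem le_above_add (s : Config S x z w) : n + ((blk S w).filter (Anc S x)).card ≤
    (Above S x w).card + (Below S w).card := by
  have h1 : (Finset.univ.filter fun y => ¬ STGe S w y) ∪ (blk S w).filter (Anc S x) ⊆
      Above S x w := by
    intro y hy
    rw [mem_above]
    rcases Finset.mem_union.1 hy with h | h
    · have h' : ¬ STGe S w y := by simpa using h
      exact ⟨not_not.1 fun hA => h' (s.highest y hA), (stge_total s.st w y).resolve_left h'⟩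
    · rw [Finset.mem_filter, mem_blk] at h
      exact ⟨h.2, h.1.2⟩
  have h2 : Disjoint (Finset.univ.filter fun y => ¬ STGe S w y) ((blk S w).filter (Anc S x)) := by
    rw [Finset.disjoint_left]
    intro y hy hy'
    rw [Finset.mem_filter, mem_blk] at hy'
    exact (Finset.mem_filter.1 hy).2 hy'.1.1
  have h3 := Finset.card_le_card h1
  rw [Finset.card_union_of_disjoint h2] at h3
  have h4 := Finset.card_filter_add_card_filter_not (s := (Finset.univ : Finset (Fin n)))
    (fun y => STGe S w y)
  rw [Finset.card_univ, Fintype.card_fin] at h4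
  change (Below S w).card + _ = _ at h4
  omega

theorem block_notMem (s : Config S x z w) {v : Fin n} (hv : Eqv S w v) : ¬ Anc S x v := by
  intro hA
  have h1 := s.lo_tight.1
  have h2 := s.le_above_add
  have h3 := card_le_of_reach (s.reach_hi ⟨s.refl w, s.refl w⟩ s.notMem)
  have h4 : upc S x w ≤ ((blk S w).filter (Anc S x)).card :=
    upc_le_fix s.sub s.st (s.top w) (s.intv_w hv) fun u hu hu' =>
      Finset.mem_filter.2 ⟨mem_blk.2 (hv.trans s.sub hu), hA.trans hu'⟩
  have h5 := lo_add_hi (S := S) x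
  have h6 := s.small
  omega

theorem block_anc (s : Config S x z w) {v v' : Fin n} (hv : Eqv S w v) (hv' : Eqv S w v') :
    Anc S v v' := by
  by_contra hcon
  have h1 := s.lo_tight.1
  have h2 := s.le_above_add
  have h3 : (Below S w).card ≤ ((Hi S x).filter fun θ => θ v' = none).card := by
    refine card_le_of_reach (x := v) fun y hy => ?_
    obtain ⟨θ, hθ, h⟩ := hv.2.trans s.sub (mem_below.1 hy)
    obtain ⟨t, ht, htl⟩ := exists_left s.sub (s.refl v) hθ
    have h' := (htl _ _).2 ⟨h, Anc.refl _⟩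
    refine ⟨t, Finset.mem_filter.2 ⟨mem_hi ht h' (s.block_notMem hv), ?_⟩, h'⟩
    by_contra hne
    obtain ⟨u, hu⟩ := Option.ne_none_iff_exists'.1 hne
    exact hcon ((htl _ _).1 hu).2
  have h4 : (Below S w).card ≤ ((Hi S x).filter fun θ => ¬ θ v' = none).card := by
    refine card_le_of_reach (x := v') fun y hy => ?_
    obtain ⟨θ, hθ, h⟩ := s.reach_hi hv' (s.block_notMem hv') y hy
    exact ⟨θ, Finset.mem_filter.2 ⟨hθ, by simp [h]⟩, h⟩
  have h5 := Finset.card_filter_add_card_filter_not (s := Hi S x) (fun θ => θ v' = none)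
  have h6 := lo_add_hi (S := S) x
  have h7 := s.small
  have h8 : (blk S w).card ≤ (Below S w).card :=
    Finset.card_le_card fun u hu => mem_below.2 (mem_blk.1 hu).1
  have h9 := Nat.le_of_dvd (Finset.card_pos.2 ⟨w, mem_blk.2 ⟨s.refl w, s.refl w⟩⟩)
    (upc_dvd s.sub s.st (s.top w) (s.intv_w ⟨s.refl w, s.refl w⟩))
  omega

theorem midCell (s : Config S x z w) {v : Fin n} (hv : Eqv S w v) : Cell S w v :=
  ⟨hv, s.block_anc ⟨s.refl w, s.refl w⟩ hv, s.block_anc hv ⟨s.refl w, s.refl w⟩⟩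

theorem move (s : Config S x z w) {x' z' w' : Fin n} (hx : Eqv S x x') (hz : Eqv S z z')
    (hw : Eqv S w w') : Config S x' z' w' where
  sub := s.sub
  st := s.st
  small := s.small
  top := fun u => hx.2.trans s.sub (s.top u)
  bot := fun u => (s.bot u).trans s.sub hz.1
  topCell := fun _ hu => (s.topCell _ hx).symm.trans s.sub (s.topCell _ (hx.trans s.sub hu))
  botCell := fun _ hu => (s.botCell _ hz).symm.trans s.sub (s.botCell _ (hz.trans s.sub hu))
  notMem := by
    rw [← (s.topCell _ hx).anc_iff]
    exact s.block_notMem hw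
  highest := fun u hu => hw.2.trans s.sub (s.highest u (by rwa [(s.topCell _ hx).anc_iff]))

theorem lo_move (s : Config S x z w) {x' : Fin n} (hx : Eqv S x x') : Lo S x' = Lo S x := by
  unfold Lo
  simp only [(s.topCell _ hx).anc_iff]

theorem hi_move (s : Config S x z w) {x' : Fin n} (hx : Eqv S x x') : Hi S x' = Hi S x := by
  unfold Hi
  simp only [(s.topCell _ hx).anc_iff]

/-- Closed pairs between the block of `w` and the points below it. -/
theorem closed_pair_card_le_bot (s : Config S x z w) {F F' : Finset (Fin n)} (hF : F ⊆ blk S w)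
    (hcl : ∀ ψ ∈ S, (∃ u ∈ F, ψ u = some z) ↔ ∃ y ∈ F', ψ w = some y) :
    F.card ≤ upc (Op S) z w := by
  refine closed_pair_card_le (op_sub s.sub) (F' := F') (fun u => op_stge.2 (s.bot u))
    (fun u hu => op_cell.2 (s.botCell u (op_eqv.1 hu)))
    (op_cell.2 ⟨⟨s.refl w, s.refl w⟩, Anc.refl w, Anc.refl w⟩)
    (fun f hf => op_cell.2 (s.midCell (mem_blk.1 (hF hf)))) fun θ hθ => ?_
  have := hcl θ.symm hθ
  simpa only [PEquiv.eq_some_iff] using this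

theorem hi_tight (s : Config S x z w) :
    (blk S w).card + (Below S w).card ≤ (Hi S x).card + upc (Op S) z w ∧
      ((Hi S x).card + upc (Op S) z w ≤ (blk S w).card + (Below S w).card →
        (∀ ψ ∈ Hi S x, (∃ u, Eqv S w u ∧ ψ u = some z) ∨ ∃ y, ψ w = some y) ∧
        ∀ ψ ∈ Hi S x, ∀ ψ' ∈ Hi S x, ψ w = some z → ψ' w = some z → ψ = ψ') := by
  have hww : Eqv S w w := ⟨s.refl w, s.refl w⟩
  have key := graph_tight (E := Hi S x) (V₁ := blk S w) (V₂ := Below S w)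
    (f := fun ψ u => Eqv S w u ∧ ψ u = some z) (g := fun ψ y => ψ w = some y)
    (t := upc (Op S) z w) (a₀ := w) (b₀ := z)
    (fun ψ _ b b' h h' => peInj h.2 h'.2)
    (fun ψ _ a a' h h' => by rw [h] at h'; exact Option.some.inj h')
    (fun _ _ _ h => mem_blk.2 h.1)
    (fun ψ hψ y h => mem_below.2 ⟨ψ, Hi.mem hψ, h⟩)
    (s.reach_hi hww s.notMem)
    (mem_blk.2 hww) (mem_below.2 (s.bot w))
    (fun _ _ => ⟨fun h => h.2, fun h => ⟨hww, h⟩⟩)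
    (fun F hF F' _ hcl => by
      refine s.closed_pair_card_le_bot hF (F' := F') fun ψ hψ => ?_
      constructor
      · rintro ⟨u, hu, huz⟩
        have hwu := mem_blk.1 (hF hu)
        exact (hcl ψ (mem_hi hψ huz (s.block_notMem hwu))).1 ⟨u, hu, hwu, huz⟩
      · rintro ⟨y, hy, hwy⟩
        obtain ⟨u, hu, hwu, huz⟩ := (hcl ψ (mem_hi hψ hwy s.notMem)).2 ⟨y, hy, hwy⟩
        exact ⟨u, hu, huz⟩)
  refine ⟨key.1, fun h => ⟨(key.2 h).1, fun ψ hψ ψ' hψ' h1 h2 => ?_⟩⟩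
  exact (key.2 h).2 ψ hψ ψ' hψ' ⟨hww, h1⟩ ⟨hww, h2⟩

end Config

theorem gcd_eq_of_add_le {t t' β p : ℕ} (hβ : 0 < β) (ht : t ∣ β) (ht' : t' ∣ β)
    (hp : Nat.gcd t t' ≤ p) (h : β + p ≤ t + t') :
    Nat.gcd t t' = p ∧ β + p = t + t' ∧ (t = p ∧ t' = β ∨ t' = p ∧ t = β) := by
  have htpos : 0 < t := Nat.pos_of_dvd_of_pos ht hβ
  obtain ⟨g, a, b, hg, hab, rfl, rfl⟩ := Nat.exists_coprime' (Nat.gcd_pos_of_pos_left t' htpos)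
  have hgcd : Nat.gcd (a * g) (b * g) = g := by rw [Nat.gcd_mul_right, hab.gcd_eq_one, one_mul]
  rw [hgcd] at hp ⊢
  obtain ⟨c, rfl⟩ := (Dvd.intro_left a rfl : g ∣ a * g).trans ht
  have ha : a ∣ c := Nat.dvd_of_mul_dvd_mul_right hg (by rwa [mul_comm c g])
  have hb : b ∣ c := Nat.dvd_of_mul_dvd_mul_right hg (by rwa [mul_comm c g])
  obtain ⟨m, rfl⟩ := hab.mul_dvd_of_dvd_of_dvd ha hb
  have hm : 0 < a * b * m := Nat.pos_of_mul_pos_left hβ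
  have hm1 : 0 < m := Nat.pos_of_mul_pos_left hm
  have hab0 : 0 < a * b := Nat.pos_of_mul_pos_right hm
  have ha0 : 0 < a := Nat.pos_of_mul_pos_right hab0
  have hb0 : 0 < b := Nat.pos_of_mul_pos_left hab0
  obtain ⟨a, rfl⟩ := Nat.exists_eq_add_of_lt ha0
  obtain ⟨b, rfl⟩ := Nat.exists_eq_add_of_lt hb0
  have h1 : g * ((0 + a + 1) * (0 + b + 1) * m) + g ≤ g * ((0 + a + 1) + (0 + b + 1)) := by
    calc _ ≤ _ := Nat.add_le_add_left hp _
      _ ≤ _ := h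
      _ = _ := by ring
  have h2 : (0 + a + 1) * (0 + b + 1) * m + 1 ≤ (0 + a + 1) + (0 + b + 1) := by
    refine Nat.le_of_mul_le_mul_left ?_ hg
    calc _ = _ := by ring
      _ ≤ _ := h1
  have h3 : (0 + a + 1) * (0 + b + 1) ≤ (0 + a + 1) * (0 + b + 1) * m :=
    Nat.le_mul_of_pos_right _ hm1
  have hab1 : a * b = 0 := by nlinarith
  have hm2 : m = 1 := by
    by_contra hne
    have : 2 ≤ m := by omega
    have := Nat.mul_le_mul_left ((0 + a + 1) * (0 + b + 1)) this
    nlinarith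
  subst hm2
  rcases Nat.mul_eq_zero.1 hab1 with rfl | rfl
  · have : p ≤ g := by nlinarith
    have : p = g := le_antisymm this hp
    subst this
    refine ⟨rfl, by ring, .inl ⟨by ring, by ring⟩⟩
  · have : p ≤ g := by nlinarith
    have : p = g := le_antisymm this hp
    subst this
    refine ⟨rfl, by ring, .inr ⟨by ring, by ring⟩⟩

theorem blk_eq (hS : IsSubsemigroup S) {x y : Fin n} (h : Eqv S x y) : blk S x = blk S y := by
  ext u
  rw [mem_blk, mem_blk]
  exact ⟨fun hu => h.symm.trans hS hu, fun hu => h.trans hS hu⟩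

theorem self_mem_blk (hst : Semitransitive S) (x : Fin n) : x ∈ blk S x :=
  mem_blk.2 ⟨stge_refl hst x, stge_refl hst x⟩

theorem dvd_of_dvd_blk (hS : IsSubsemigroup S) (hst : Semitransitive S) {g : ℕ}
    (h : ∀ y, g ∣ (blk S y).card) : g ∣ n := by
  have h1 := Finset.card_eq_sum_card_image (blk S) Finset.univ
  rw [Finset.card_univ, Fintype.card_fin] at h1
  rw [h1]
  apply Finset.dvd_sum
  intro s hs
  obtain ⟨z, -, rfl⟩ := Finset.mem_image.1 hs
  have : Finset.univ.filter (fun u => blk S u = blk S z) = blk S z := by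
    ext u
    simp only [Finset.mem_filter, Finset.mem_univ, true_and]
    constructor
    · intro hu
      rw [← hu]
      exact self_mem_blk hst u
    · intro hu
      exact (blk_eq hS (mem_blk.1 hu)).symm
  rw [this]
  exact h z

namespace Config

variable {x z w : Fin n} {p : ℕ}

theorem eqv_w (s : Config S x z w) : Eqv S w w := ⟨s.refl w, s.refl w⟩

theorem numerics (s : Config S x z w) (hN : (Nz S).card + p = 2 * n)
    (hpmax : ∀ d : ℕ, d ∣ n → d < n → d ≤ p) :
    (∀ y, p ∣ (blk S y).card) ∧ (Lo S x).card + upc S x w ≤ n + (Above S x w).card ∧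
      (Hi S x).card + upc (Op S) z w ≤ (blk S w).card + (Below S w).card ∧
      (upc S x w = p ∧ upc (Op S) z w = (blk S w).card ∨
        upc (Op S) z w = p ∧ upc S x w = (blk S w).card) := by
  have hzw : STGe (Op S) z w := op_stge.2 (s.bot w)
  have hdvd : ∀ y, Nat.gcd (upc S x w) (upc (Op S) z w) ∣ (blk S y).card := by
    intro y
    rcases stge_total s.st w y with h | h
    · rw [← op_blk]
      exact (Nat.gcd_dvd_right _ _).trans (upc_dvd (op_sub s.sub) (op_st s.st) hzw
        ⟨op_stge.2 (s.bot y), op_stge.2 h⟩)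
    · exact (Nat.gcd_dvd_left _ _).trans (upc_dvd s.sub s.st (s.top w) ⟨s.top y, h⟩)
  have hβ : 0 < (blk S w).card := Finset.card_pos.2 ⟨w, self_mem_blk s.st w⟩
  have hβn : (blk S w).card < n := by
    have : (blk S w).card < (Finset.univ : Finset (Fin n)).card := by
      apply Finset.card_lt_card
      rw [Finset.ssubset_univ_iff]
      intro h
      exact s.block_notMem (mem_blk.1 (h ▸ Finset.mem_univ x)) (Anc.refl x)
    rwa [Finset.card_univ, Fintype.card_fin] at this
  have hgp := hpmax _ (dvd_of_dvd_blk s.sub s.st hdvd)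
    (lt_of_le_of_lt (Nat.le_of_dvd hβ (hdvd w)) hβn)
  have h1 := s.lo_tight.1
  have h2 := s.le_above_add
  have h3 := s.hi_tight.1
  have h4 := lo_add_hi (S := S) x
  obtain ⟨h5, h6, h7⟩ := gcd_eq_of_add_le hβ
    (upc_dvd s.sub s.st (s.top w) (s.intv_w s.eqv_w))
    (by
      rw [← op_blk]
      exact upc_dvd (op_sub s.sub) (op_st s.st) hzw ⟨hzw, op_stge.2 (s.refl w)⟩) hgp (by omega)
  exact ⟨fun y => h5 ▸ hdvd y, by omega, by omega, h7⟩

theorem above_move (s : Config S x z w) {x' w' : Fin n} (hx : Eqv S x x') (hw : Eqv S w w') :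
    Above S x' w' = Above S x w := by
  ext y
  rw [mem_above, mem_above, (s.topCell _ hx).anc_iff]
  exact and_congr_right fun _ => ⟨fun h => h.trans s.sub hw.2, fun h => h.trans s.sub hw.1⟩

theorem below_move (s : Config S x z w) {w' : Fin n} (hw : Eqv S w w') :
    Below S w' = Below S w := by
  ext y
  rw [mem_below, mem_below]
  exact ⟨fun h => hw.1.trans s.sub h, fun h => hw.2.trans s.sub h⟩

theorem lo_end (s : Config S x z w) (ht : (Lo S x).card + upc S x w ≤ n + (Above S x w).card)
    {x' w' : Fin n} (hx : Eqv S x x') (hw : Eqv S w w') {θ : ISemi n} (hθ : θ ∈ Lo S x) :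
    (∃ a, θ x' = some a) ∨ ∃ b, θ b = some w' := by
  have s' := s.move hx (⟨s.refl z, s.refl z⟩ : Eqv S z z) hw
  refine (s'.lo_tight.2 ?_).1 θ (by rwa [s.lo_move hx])
  rwa [s.lo_move hx, s.above_move hx hw, ← upc_congr s.sub s.st (s.top w) hx hw]

theorem lo_unique (s : Config S x z w) (ht : (Lo S x).card + upc S x w ≤ n + (Above S x w).card)
    {x' w' : Fin n} (hx : Eqv S x x') (hw : Eqv S w w') {θ θ' : ISemi n} (hθ : θ ∈ Lo S x)
    (hθ' : θ' ∈ Lo S x) (h : θ x' = some w') (h' : θ' x' = some w') : θ = θ' := by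
  have s' := s.move hx (⟨s.refl z, s.refl z⟩ : Eqv S z z) hw
  refine (s'.lo_tight.2 ?_).2 θ (by rwa [s.lo_move hx]) θ' (by rwa [s.lo_move hx]) h h'
  rwa [s.lo_move hx, s.above_move hx hw, ← upc_congr s.sub s.st (s.top w) hx hw]

theorem upc_op_move (s : Config S x z w) {z' w' : Fin n} (hz : Eqv S z z') (hw : Eqv S w w') :
    upc (Op S) z w = upc (Op S) z' w' :=
  upc_congr (op_sub s.sub) (op_st s.st) (op_stge.2 (s.bot w)) (op_eqv.2 hz) (op_eqv.2 hw)

theorem hi_end (s : Config S x z w)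
    (ht : (Hi S x).card + upc (Op S) z w ≤ (blk S w).card + (Below S w).card)
    {z' w' : Fin n} (hz : Eqv S z z') (hw : Eqv S w w') {ψ : ISemi n} (hψ : ψ ∈ Hi S x) :
    (∃ u, Eqv S w' u ∧ ψ u = some z') ∨ ∃ y, ψ w' = some y := by
  have s' := s.move (⟨s.refl x, s.refl x⟩ : Eqv S x x) hz hw
  refine (s'.hi_tight.2 ?_).1 ψ hψ
  rwa [← blk_eq s.sub hw, s.below_move hw, ← s.upc_op_move hz hw]

theorem hi_unique (s : Config S x z w)
    (ht : (Hi S x).card + upc (Op S) z w ≤ (blk S w).card + (Below S w).card)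
    {z' w' : Fin n} (hz : Eqv S z z') (hw : Eqv S w w') {ψ ψ' : ISemi n} (hψ : ψ ∈ Hi S x)
    (hψ' : ψ' ∈ Hi S x) (h : ψ w' = some z') (h' : ψ' w' = some z') : ψ = ψ' := by
  have s' := s.move (⟨s.refl x, s.refl x⟩ : Eqv S x x) hz hw
  refine (s'.hi_tight.2 ?_).2 ψ hψ ψ' hψ' h h'
  rwa [← blk_eq s.sub hw, s.below_move hw, ← s.upc_op_move hz hw]

theorem lo_trans (s : Config S x z w) {θ τ : ISemi n} (hθ : θ ∈ Lo S x) (hτ : τ ∈ S) {u v : Fin n}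
    (h : (θ.trans τ) u = some v) : θ.trans τ ∈ Lo S x :=
  mem_lo (s.sub _ (Lo.mem hθ) _ hτ) h fun _ _ h' =>
    let ⟨_, h1, _⟩ := (PEquiv.trans_eq_some _ _ _ _).1 h'
    Lo.dom hθ h1

/-- In the tight case, a map defined on the top block and sending some of it to the block of `w`
sends all of it there. -/
theorem lo_image (s : Config S x z w) (ht : (Lo S x).card + upc S x w ≤ n + (Above S x w).card)
    (hHi : (Hi S x).card ≤ (Below S w).card) (hsing : ∃ u, ¬ Anc S w u) {θ : ISemi n}
    (hθ : θ ∈ Lo S x) (hxw : θ x = some w) {x' y : Fin n} (hx' : Eqv S x x')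
    (hy : θ x' = some y) : Eqv S w y := by
  have hS := s.sub
  have hxx : Eqv S x x := ⟨s.refl x, s.refl x⟩
  have hwy : Anc S w y := by
    obtain ⟨e, he, hp, hu⟩ := exists_least hS (s.refl w)
    have h1 := trans_some hxw ((hu w).2 (Anc.refl w))
    have h2 := s.lo_unique ht hxx s.eqv_w hθ (s.lo_trans hθ he h1) hxw h1
    rw [h2] at hy
    obtain ⟨v, -, h4⟩ := (PEquiv.trans_eq_some _ _ _ _).1 hy
    have := hp _ _ h4
    subst this
    exact (hu _).1 h4
  have hge : STGe S w y := by
    by_contra hcon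
    have hA : Anc S x y := not_not.1 fun h => hcon (s.highest y h)
    obtain ⟨e, he, hp, hu⟩ := exists_least hS (s.refl y)
    have h1 := trans_some hy ((hu y).2 (Anc.refl y))
    have h0 : Anc S y w := by
      rcases s.lo_end ht hxx s.eqv_w (s.lo_trans hθ he h1) with ⟨a, ha⟩ | ⟨b, hb⟩
      · obtain ⟨v, h3, h4⟩ := (PEquiv.trans_eq_some _ _ _ _).1 ha
        rw [hxw] at h3
        cases h3
        have := hp _ _ h4
        subst this
        exact (hu _).1 h4
      · obtain ⟨v, -, h4⟩ := (PEquiv.trans_eq_some _ _ _ _).1 hb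
        have := hp _ _ h4
        subst this
        exact (hu _).1 h4
    exact s.notMem (hA.trans h0)
  refine ⟨hge, ?_⟩
  by_contra hcon
  obtain ⟨χ', hχ', hwy'⟩ := hge
  obtain ⟨χ, hχ, hχc⟩ := exists_corner hS (s.refl w) hχ'
  have hχw := (hχc _ _).2 ⟨hwy', Anc.refl _, hwy⟩
  have hex : ∃ m, pePow χ m w = none := by
    obtain ⟨k, hk⟩ := exists_pid_pow χ
    refine ⟨k + 2, ?_⟩
    by_contra hne
    obtain ⟨v, hv⟩ := Option.ne_none_iff_exists'.1 hne
    have := hk _ _ hv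
    subst this
    rw [show k + 2 = 1 + (k + 1) by ring, pePow_add, pePow_one, PEquiv.trans_eq_some] at hv
    obtain ⟨v, h1, h2⟩ := hv
    rw [hχw] at h1
    cases h1
    exact hcon ⟨_, pePow_mem hS hχ k, h2⟩
  have hm := Nat.find_spec hex
  have hm' := fun k => Nat.find_min (m := k) hex
  generalize Nat.find hex = m at hm hm'
  obtain ⟨k, rfl⟩ : ∃ k, m = k + 2 := by
    rcases m with _ | _ | k
    · simp [pePow] at hm
    · rw [zero_add, pePow_one, hχw] at hm
      cases hm
    · exact ⟨k, rfl⟩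
  obtain ⟨v₁, hv₁⟩ := Option.ne_none_iff_exists'.1 (hm' (k + 1) (by omega))
  set σ := pePow χ (k + 1) with hσ
  have hσS : σ ∈ S := pePow_mem hS hχ k
  have hσdom : ∀ u v, σ u = some v → Anc S w u ∧ Anc S w v := by
    intro u v huv
    constructor
    · rw [hσ, add_comm, pePow_add, pePow_one, PEquiv.trans_eq_some] at huv
      obtain ⟨u', h1, -⟩ := huv
      exact ((hχc _ _).1 h1).2.1
    · rw [hσ, pePow, PEquiv.trans_eq_some] at huv
      obtain ⟨u', -, h1⟩ := huv
      exact ((hχc _ _).1 h1).2.2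
  have hund : ∀ v, ¬ pePow χ (k + 2) w = some v := by
    intro v hv
    rw [hm] at hv
    cases hv
  have hlo := s.lo_trans hθ hσS (trans_some hxw hv₁)
  rcases s.lo_end ht hx' s.eqv_w hlo with ⟨a, ha⟩ | ⟨b, hb⟩
  · obtain ⟨v, h3, h4⟩ := (PEquiv.trans_eq_some _ _ _ _).1 ha
    rw [hy] at h3
    cases h3
    refine hund a ?_
    rw [show k + 2 = 1 + (k + 1) by ring, pePow_add, pePow_one]
    exact trans_some hχw h4
  · obtain ⟨v, -, hvw⟩ := (PEquiv.trans_eq_some _ _ _ _).1 hb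
    have hAv := (hσdom _ _ hvw).1
    by_cases hge : STGe S w v
    · obtain ⟨ρ', hρ', hwv'⟩ := hge
      obtain ⟨ρ, hρ, hρc⟩ := exists_corner hS (s.refl w) hρ'
      have hwv := (hρc _ _).2 ⟨hwv', Anc.refl _, hAv⟩
      have hun := (un_of_fix hS hρ hσS (fun u v h => ((hρc _ _).1 h).2) hσdom
        (trans_some hwv hvw)).2
      obtain ⟨v₂, hv₂⟩ := (hun.dom v₁).2 (hσdom _ _ hv₁).2
      have h2 := trans_some hv₁ hv₂
      rw [hσ, ← pePow_add, show k + 1 + (k + 1) = (k + 2) + k by ring, pePow_add,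
        PEquiv.trans_eq_some] at h2
      obtain ⟨v₃, h3, -⟩ := h2
      exact hund _ h3
    · have hAx : Anc S x v := not_not.1 fun h => hge (s.highest v h)
      obtain ⟨e, he, hp, hu⟩ := exists_least hS (s.refl v)
      have hdom : ∀ u u', e u = some u' → Anc S v u := by
        intro u u' h
        have := hp _ _ h
        subst this
        exact (hu _).1 h
      have heL : e ∈ Lo S x := mem_lo he ((hu v).2 (Anc.refl v)) fun u u' h => hAx.trans (hdom u u' h)
      have hvx : Anc S v x := by
        rcases s.lo_end ht hxx s.eqv_w heL with ⟨a, ha⟩ | ⟨b, hb⟩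
        · exact hdom _ _ ha
        · have := hp _ _ hb
          subst this
          exact absurd (hAx.trans (hdom _ _ hb)) s.notMem
      obtain ⟨u₀, hu₀⟩ := hsing
      have hnu : ¬ Anc S x u₀ := fun h => hu₀ (hAv.trans (hvx.trans h))
      have hreach := reach_of_card_le (s.reach_hi s.eqv_w s.notMem) hHi
      obtain ⟨e₀, he₀, hp₀, hE₀⟩ := exists_least hS (s.refl u₀)
      obtain ⟨e₁, he₁, hp₁, hE₁⟩ := exists_least hS (s.refl w)
      have h1 : e₀ ∈ Hi S x := mem_hi he₀ ((hE₀ u₀).2 (Anc.refl u₀)) hnu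
      have h2 : e₁ ∈ Hi S x := mem_hi he₁ ((hE₁ w).2 (Anc.refl w)) s.notMem
      obtain ⟨y₀, hy₀⟩ := hreach.1 e₀ h1
      have := hp₀ _ _ hy₀
      subst this
      have h3 := hreach.2 e₀ h1 e₁ h2 _ hy₀ ((hE₁ _).2 (Anc.refl _))
      exact hu₀ ((hE₁ _).1 (h3 ▸ (hE₀ u₀).2 (Anc.refl u₀)))

/-- In the tight case, a map sending a top point to `w` and reaching the block of `w` from `v` has
`v` in the top block. -/
theorem lo_preimage (s : Config S x z w)
    (ht : (Lo S x).card + upc S x w ≤ n + (Above S x w).card) {θ : ISemi n} (hθ : θ ∈ Lo S x)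
    (hxw : θ x = some w) {v w₂ : Fin n}
    (hw₂ : Eqv S w w₂) (hv : θ v = some w₂) : Eqv S x v := by
  have hS := s.sub
  obtain ⟨κ', hκ', hxv'⟩ := s.top v
  obtain ⟨κ, hκ, hκl⟩ := exists_left hS (s.refl x) hκ'
  have hxv := (hκl _ _).2 ⟨hxv', Anc.refl x⟩
  obtain ⟨h, hh, hww⟩ := (s.midCell s.eqv_w).exists_un hS (s.midCell hw₂)
  have hxw₂ := trans_some hxv hv
  have h1 : κ.trans θ ∈ Lo S x := by
    refine mem_lo (hS _ hκ _ (Lo.mem hθ)) hxw₂ fun u u' huu => ?_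
    obtain ⟨_, h2, -⟩ := (PEquiv.trans_eq_some _ _ _ _).1 huu
    exact ((hκl _ _).1 h2).2
  have hxw₂' := trans_some hxw hww
  have heq := s.lo_unique ht ⟨s.refl x, s.refl x⟩ hw₂ h1 (s.lo_trans hθ hh.mem hxw₂') hxw₂ hxw₂'
  refine ⟨s.top v, STGe.of_stable hS hκ (K := {u | ∃ w', Eqv S w w' ∧ θ u = some w'}) ?_
    ⟨w, s.eqv_w, hxw⟩ hxv⟩
  rintro u ⟨w₃, hw₃, hu⟩
  obtain ⟨w₄, hw₄⟩ := (hh.dom w₃).2 (s.midCell hw₃).anc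
  have h3 := trans_some hu hw₄
  rw [← heq] at h3
  obtain ⟨u', h4, h5⟩ := (PEquiv.trans_eq_some _ _ _ _).1 h3
  exact ⟨u', ⟨w₄, (hh.cell hS (s.midCell hw₃) hw₄).eqv, h5⟩, h4⟩

theorem small_top_or_mid (s : Config S x z w)
    (ht : (Lo S x).card + upc S x w ≤ n + (Above S x w).card)
    (hHi : (Hi S x).card ≤ (Below S w).card) (hsing : ∀ v, ∃ u, ¬ Anc S v u) :
    (blk S x).card ≤ upc S x w ∨ (blk S w).card ≤ upc S x w := by
  have hS := s.sub
  have hxx : Eqv S x x := ⟨s.refl x, s.refl x⟩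
  set M := (Lo S x).filter fun θ => ∃ x' w', Eqv S x x' ∧ Eqv S w w' ∧ θ x' = some w' with hM
  have hML : ∀ {θ}, θ ∈ M → θ ∈ Lo S x := fun h => (Finset.mem_filter.1 h).1
  have hres : ∀ θ ∈ S, ∀ x' w', Eqv S x x' → Eqv S w w' → θ x' = some w' →
      ∃ t ∈ M, (∀ u v, t u = some v ↔ θ u = some v ∧ Anc S x u) := by
    intro θ hθ x' w' hx' hw' h
    obtain ⟨t, -, h1, h2⟩ := s.exists_to_lo hθ
    have h3 := (h1 x' w').2 ⟨h, (s.topCell _ hx').anc⟩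
    exact ⟨t, Finset.mem_filter.2 ⟨h2 _ _ h3, x', w', hx', hw', h3⟩, h1⟩
  have hcount := (graph_tight (E := M) (V₁ := blk S w) (V₂ := blk S x)
    (f := fun θ y => Eqv S w y ∧ θ x = some y) (g := fun θ u => Eqv S x u ∧ θ u = some w)
    (t := upc S x w) (a₀ := w) (b₀ := x)
    (fun θ _ a a' h h' => by
      have h1 := h.2
      rw [h'.2] at h1
      exact (Option.some.inj h1).symm)
    (fun θ _ b b' h h' => peInj h.2 h'.2) (fun _ _ _ h => mem_blk.2 h.1)
    (fun _ _ _ h => mem_blk.2 h.1)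
    (fun b hb => by
      have hb' := mem_blk.1 hb
      obtain ⟨θ, hθ, h⟩ := hb'.2.trans hS (s.top w)
      obtain ⟨t, ht, h1⟩ := hres θ hθ b w hb' s.eqv_w h
      exact ⟨t, ht, hb', (h1 _ _).2 ⟨h, (s.topCell _ hb').anc⟩⟩)
    (mem_blk.2 s.eqv_w) (mem_blk.2 hxx)
    (fun _ _ => ⟨fun h => ⟨hxx, h.2⟩, fun h => ⟨s.eqv_w, h.2⟩⟩)
    (fun F hF F' hF' hcl => by
      refine closed_pair_card_le s.sub s.top s.topCell (s.midCell s.eqv_w) (F' := F')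
        (fun f hf => s.midCell (mem_blk.1 (hF hf))) fun θ hθ => ?_
      constructor
      · rintro ⟨a, ha, hxa⟩
        have ha' := mem_blk.1 (hF ha)
        obtain ⟨t, ht, h1⟩ := hres θ hθ x a hxx ha' hxa
        obtain ⟨b, hb, -, hbw⟩ := (hcl t ht).1 ⟨a, ha, ha', (h1 _ _).2 ⟨hxa, Anc.refl x⟩⟩
        exact ⟨b, hb, ((h1 _ _).1 hbw).1⟩
      · rintro ⟨b, hb, hbw⟩
        have hb' := mem_blk.1 (hF' hb)
        obtain ⟨t, ht, h1⟩ := hres θ hθ b w hb' s.eqv_w hbw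
        obtain ⟨a, ha, -, hxa⟩ := (hcl t ht).2
          ⟨b, hb, hb', (h1 _ _).2 ⟨hbw, (s.topCell _ hb').anc⟩⟩
        exact ⟨a, ha, ((h1 _ _).1 hxa).1⟩)).1
  refine card_le_of_unique_joins (M := M) ⟨x, self_mem_blk s.st x⟩ ⟨w, self_mem_blk s.st w⟩ ?_ ?_
    (by omega)
  · intro a ha b hb θ hθ θ' hθ' h h'
    exact s.lo_unique ht (mem_blk.1 ha) (mem_blk.1 hb) (hML hθ) (hML hθ') h h'
  · intro θ hθ
    obtain ⟨hL, x', w', hx', hw', hxw⟩ := Finset.mem_filter.1 hθ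
    have s' := s.move hx' (⟨s.refl z, s.refl z⟩ : Eqv S z z) hw'
    have ht' : (Lo S x').card + upc S x' w' ≤ n + (Above S x' w').card := by
      rwa [s.lo_move hx', s.above_move hx' hw', ← upc_congr s.sub s.st (s.top w) hx' hw']
    have hL' : θ ∈ Lo S x' := by rwa [s.lo_move hx']
    by_cases hdom : ∀ a ∈ blk S x, ∃ b, θ a = some b
    · left
      intro a ha
      obtain ⟨b, hb⟩ := hdom a ha
      have := s'.lo_image ht' (by rwa [s.hi_move hx', s.below_move hw']) (hsing w') hL' hxw
        (hx'.symm.trans hS (mem_blk.1 ha)) hb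
      exact ⟨b, mem_blk.2 (hw'.trans hS this), hb⟩
    · right
      push Not at hdom
      obtain ⟨a, ha, hna⟩ := hdom
      have hW : ∀ w₂, Eqv S w w₂ → ∃ v, θ v = some w₂ := by
        intro w₂ hw₂
        refine (s.lo_end ht (mem_blk.1 ha) hw₂ hL).resolve_left ?_
        rintro ⟨b, hb⟩
        exact hna b hb
      intro b hb
      obtain ⟨v, hv⟩ := hW b (mem_blk.1 hb)
      have := s'.lo_preimage ht' hL' hxw
        (hw'.symm.trans hS (mem_blk.1 hb)) hv
      exact ⟨v, mem_blk.2 (hx'.trans hS this), hv⟩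

theorem hi_image (s : Config S x z w)
    (ht : (Hi S x).card + upc (Op S) z w ≤ (blk S w).card + (Below S w).card) {ψ : ISemi n}
    (hψ : ψ ∈ Hi S x) (hwz : ψ w = some z) (hW : ∀ w', Eqv S w w' → ∃ y, ψ w' = some y)
    {w₂ y : Fin n} (hw₂ : Eqv S w w₂) (hy : ψ w₂ = some y) : Eqv S z y := by
  have hS := s.sub
  obtain ⟨χ, hχ, hyz⟩ := s.bot y
  obtain ⟨h, hh, hww⟩ := (s.midCell s.eqv_w).exists_un hS (s.midCell hw₂)
  have h1 := trans_some (trans_some hww hy) hyz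
  have heq := s.hi_unique ht ⟨s.refl z, s.refl z⟩ s.eqv_w hψ
    (mem_hi (hS _ (hS _ hh.mem _ (Hi.mem hψ)) _ hχ) h1 s.notMem) hwz h1
  refine ⟨STGe.of_stable hS hχ (K := {y | ∃ w', Eqv S w w' ∧ ψ w' = some y}) ?_ ⟨w₂, hw₂, hy⟩ hyz,
    s.bot y⟩
  rintro u ⟨w₃, hw₃, hu⟩
  obtain ⟨w₄, hw₄⟩ := (hh.ran w₃).2 (s.midCell hw₃).anc
  have hc : Eqv S w w₄ :=
    (hh.symm.cell hS (s.midCell hw₃) ((PEquiv.eq_some_iff _).2 hw₄)).eqv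
  obtain ⟨v, hv⟩ := hW w₄ hc
  refine ⟨v, ⟨w₄, hc, hv⟩, ?_⟩
  rw [heq] at hv
  obtain ⟨u', h3, h4⟩ := (PEquiv.trans_eq_some _ _ _ _).1 hv
  obtain ⟨u'', h5, h6⟩ := (PEquiv.trans_eq_some _ _ _ _).1 h3
  rw [hw₄] at h5
  cases h5
  rw [hu] at h6
  cases h6
  exact h4

theorem small_mid_or_bot (s : Config S x z w)
    (ht : (Hi S x).card + upc (Op S) z w ≤ (blk S w).card + (Below S w).card) :
    (blk S w).card ≤ upc (Op S) z w ∨ (blk S z).card ≤ upc (Op S) z w := by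
  have hS := s.sub
  have hzz : Eqv S z z := ⟨s.refl z, s.refl z⟩
  have hxx : Eqv S x x := ⟨s.refl x, s.refl x⟩
  set M := (Hi S x).filter fun ψ => ∃ w' z', Eqv S w w' ∧ Eqv S z z' ∧ ψ w' = some z' with hM
  have hML : ∀ {θ}, θ ∈ M → θ ∈ Hi S x := fun h => (Finset.mem_filter.1 h).1
  have hmem : ∀ ψ ∈ S, ∀ w' z', Eqv S w w' → Eqv S z z' → ψ w' = some z' → ψ ∈ M :=
    fun ψ hψ w' z' hw' hz' h =>
      Finset.mem_filter.2 ⟨mem_hi hψ h (s.block_notMem hw'), w', z', hw', hz', h⟩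
  have hcount := (graph_tight (E := M) (V₁ := blk S w) (V₂ := blk S z)
    (f := fun ψ u => Eqv S w u ∧ ψ u = some z) (g := fun ψ y => Eqv S z y ∧ ψ w = some y)
    (t := upc (Op S) z w) (a₀ := w) (b₀ := z) (fun ψ _ b b' h h' => peInj h.2 h'.2)
    (fun θ _ a a' h h' => by
      have h1 := h.2
      rw [h'.2] at h1
      exact (Option.some.inj h1).symm)
    (fun _ _ _ h => mem_blk.2 h.1) (fun _ _ _ h => mem_blk.2 h.1)
    (fun y hy => by
      have hy' := mem_blk.1 hy
      obtain ⟨ψ, hψ, h⟩ := (s.bot w).trans hS hy'.1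
      exact ⟨ψ, hmem ψ hψ w y s.eqv_w hy' h, hy', h⟩)
    (mem_blk.2 s.eqv_w) (mem_blk.2 hzz)
    (fun _ _ => ⟨fun h => ⟨hzz, h.2⟩, fun h => ⟨s.eqv_w, h.2⟩⟩)
    (fun F hF F' hF' hcl => by
      refine s.closed_pair_card_le_bot hF (F' := F') fun ψ hψ => ?_
      constructor
      · rintro ⟨u, hu, huz⟩
        have hu' := mem_blk.1 (hF hu)
        obtain ⟨y, hy, -, h⟩ := (hcl ψ (hmem ψ hψ u z hu' hzz huz)).1 ⟨u, hu, hu', huz⟩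
        exact ⟨y, hy, h⟩
      · rintro ⟨y, hy, hwy⟩
        have hy' := mem_blk.1 (hF' hy)
        obtain ⟨u, hu, -, h⟩ := (hcl ψ (hmem ψ hψ w y s.eqv_w hy' hwy)).2 ⟨y, hy, hy', hwy⟩
        exact ⟨u, hu, h⟩)).1
  refine card_le_of_unique_joins (M := M) ⟨w, self_mem_blk s.st w⟩ ⟨z, self_mem_blk s.st z⟩ ?_ ?_
    hcount
  · intro a ha b hb θ hθ θ' hθ' h h'
    exact s.hi_unique ht (mem_blk.1 hb) (mem_blk.1 ha) (hML hθ) (hML hθ') h h'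
  · intro ψ hψ
    obtain ⟨hL, w', z', hw', hz', hwz⟩ := Finset.mem_filter.1 hψ
    by_cases hdom : ∀ a ∈ blk S w, ∃ b, ψ a = some b
    · left
      intro a ha
      obtain ⟨b, hb⟩ := hdom a ha
      have s' := s.move hxx hz' hw'
      have := s'.hi_image
        (by rwa [← blk_eq s.sub hw', s.below_move hw', ← s.upc_op_move hz' hw']) hL hwz
        (fun w₂ h => hdom w₂ (mem_blk.2 (hw'.trans hS h))) (hw'.symm.trans hS (mem_blk.1 ha)) hb
      exact ⟨b, mem_blk.2 (hz'.trans hS this), hb⟩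
    · right
      push Not at hdom
      obtain ⟨a, ha, hna⟩ := hdom
      intro b hb
      obtain ⟨u, hu, hub⟩ := (s.hi_end ht (mem_blk.1 hb) (mem_blk.1 ha) hL).resolve_right (by
        rintro ⟨y, hy⟩
        exact hna y hy)
      exact ⟨u, mem_blk.2 ((mem_blk.1 ha).trans hS hu), hub⟩

end Config

theorem exists_config (hS : IsSubsemigroup S) (hst : Semitransitive S)
    (hsing : ∀ φ ∈ S, IsSingular φ) (hn : 0 < n) (hN : (Nz S).card < 2 * n) :
    ∃ x z w, Config S x z w := by
  obtain ⟨x, -, hx⟩ := exists_highest hS hst (s := Set.univ) ⟨⟨0, hn⟩, trivial⟩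
  obtain ⟨z, -, hz⟩ := exists_highest (op_sub hS) (op_st hst) (s := Set.univ) ⟨⟨0, hn⟩, trivial⟩
  obtain ⟨w, hw, hwmax⟩ := exists_highest hS hst (s := {u | ¬ Anc S x u})
    (exists_not_anc hS hst hsing x)
  refine ⟨x, z, w, hS, hst, hN, fun u => hx u trivial, fun u => op_stge.1 (hz u trivial),
    fun u hu => top_cell hS hst hN (fun u => hx u trivial) hu, fun u hu => op_cell.1
      (top_cell (op_sub hS) (op_st hst) (by rwa [op_nz]) (fun u => hz u trivial) (op_eqv.2 hu)),
    hw, hwmax⟩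

theorem ncard_stblock (x : Fin n) : (STBlock S x).ncard = (blk S x).card := by
  have : STBlock S x = (blk S x : Set (Fin n)) := by
    ext y
    rw [Finset.mem_coe, mem_blk]
    rfl
  rw [this, Set.ncard_coe_finset]

end Helpers

/-- if `p` is the greatest proper divisor of `n ≥ 2` and `S` is a
semitransitive subsemigroup of the singular part of minimal cardinality
`|S| = 2n - p + 1`, then the minimal cardinality of a transitivity block of `S`
equals `p`, and every transitivity block has cardinality divisible by `p`. -/
theorem stmt15 (n p : ℕ) (hn : 2 ≤ n)
    (hpd : p ∣ n) (hplt : p < n) (hpmax : ∀ d : ℕ, d ∣ n → d < n → d ≤ p)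
    (S : Set (ISemi n))
    (hsub : IsSubsemigroup S)
    (hsing : ∀ φ ∈ S, IsSingular φ)
    (hst : Semitransitive S)
    (hcard : S.ncard = 2 * n - p + 1) :
    (∀ x : Fin n, p ≤ (STBlock S x).ncard) ∧
    (∃ x : Fin n, (STBlock S x).ncard = p) ∧
    (∀ x : Fin n, p ∣ (STBlock S x).ncard) := by
  have hp : 0 < p := Nat.pos_of_dvd_of_pos hpd (by omega)
  have hN : (Nz S).card + p = 2 * n := by
    rw [ncard_eq hsub hst hsing (by omega)] at hcard
    omega
  obtain ⟨x, z, w, s⟩ := exists_config hsub hst hsing (by omega) (by omega)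
  obtain ⟨hdvd, hlo, hhi, hcases⟩ := s.numerics hN hpmax
  have hpos : ∀ y, 0 < (blk S y).card := fun y => Finset.card_pos.2 ⟨y, self_mem_blk hst y⟩
  have hle : ∀ y, p ≤ (blk S y).card := fun y => Nat.le_of_dvd (hpos y) (hdvd y)
  simp only [ncard_stblock]
  refine ⟨hle, ?_, hdvd⟩
  rcases hcases with ⟨h1, h2⟩ | ⟨h1, -⟩
  · have := s.small_top_or_mid hlo (by omega) (exists_not_anc hsub hst hsing)
    rw [h1] at this
    rcases this with h | h
    · exact ⟨x, le_antisymm h (hle x)⟩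
    · exact ⟨w, le_antisymm h (hle w)⟩
  · have := s.small_mid_or_bot hhi
    rw [h1] at this
    rcases this with h | h
    · exact ⟨w, le_antisymm h (hle w)⟩
    · exact ⟨z, le_antisymm h (hle z)⟩
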